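/- Consider the bilinear saddle point problem min_{u∈C} max_{v∈D} g(u,v) with g(u,v) = ⟨u,s⟩ + ⟨Lu,v⟩ − ⟨b,v⟩, where C ⊆ ℝ^n and D ⊆ ℝ^m are nonempty compact convex sets with C ⊆ B_{r₁}(c₁), c₁ ∈ C, D ⊆ B_{r₂}(c₂), c₂ ∈ D, r₁, r₂ > 0, and L ∈ ℝ^{m×n}, L ≠ 0, s ∈ ℝ^n, b ∈ ℝ^m. Fix N ∈ ℕ and run Nesterov's smoothing algorithm: set μ := (2‖L‖/(N+1))·(r₁/r₂); initialize x⁽⁰⁾ ∈ C, G⁽⁻¹⁾ = 0, w⁽⁻¹⁾ = 0; for k = 0,…,N set V := Π_D(c₂ + (1/μ)(Lx⁽ᵏ⁾ − b)), w⁽ᵏ⁾ := w⁽ᵏ⁻¹⁾ + (k+1)V, v⁽ᵏ⁾ := (2/((k+1)(k+2)))·w⁽ᵏ⁾, G := s + LᵀV, G⁽ᵏ⁾ := G⁽ᵏ⁻¹⁾ + ((k+1)/2)·G, u⁽ᵏ⁾ := Π_C(x⁽ᵏ⁾ − (μ/‖L‖²)G), z⁽ᵏ⁾ := Π_C(c₁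 − (μ/‖L‖²)G⁽ᵏ⁾), x⁽ᵏ⁺¹⁾ := (2/(k+3))z⁽ᵏ⁾ + (1 − 2/(k+3))u⁽ᵏ⁾. Then all iterates satisfy u⁽ᵏ⁾ ∈ C and v⁽ᵏ⁾ ∈ D, and for every constant Ĉ ≥ ‖L‖ and every minimizer u* of f over C, the final iterates satisfy f(u⁽ᴺ⁾) − f(u*) ≤ f(u⁽ᴺ⁾) − f_D(v⁽ᴺ⁾) ≤ 2 r₁ r₂ Ĉ/(N+1). -/

import Mathlib

set_option linter.all false
namespace Nst
/-- one elimination step: `a * rest - row * rowᵀ` on upper triangular rows -/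
def upd (a : ℤ) : List ℤ → List (List ℤ) → List (List ℤ)
  | c :: cs, r :: rs => List.zipWith (fun x y => a * x - c * y) r (c :: cs) :: upd a cs rs
  | _, _ => []

/-- positive definiteness test by repeated elimination -/
def psd : ℕ → List (List ℤ) → Bool
  | 0, _ => true
  | n + 1, (a :: row) :: rest => decide (0 < a) && psd n (upd a row rest)
  | _ + 1, _ => false

/-- shape of an upper triangular array -/
def Shp : ℕ → List (List ℤ) → Prop
  | 0, rows => rows = []
  | n + 1, r :: rs => r.length = n + 1 ∧ Shp n rs
  | _ + 1, [] => False

section Sound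
variable {X : Type*} [AddCommGroup X] [Module ℝ X]

/-- linear combination -/
def lin : List ℤ → List X → X
  | c :: cs, x :: xs => (c : ℝ) • x + lin cs xs
  | _, _ => 0

/-- quadratic form given by an upper triangular integer array -/
noncomputable def evq (B : LinearMap.BilinForm ℝ X) : List (List ℤ) → List X → ℝ
  | (a :: row) :: rest, x :: xs => (a : ℝ) * B x x + 2 * B x (lin row xs) + evq B rest xs
  | _, _ => 0

theorem shp_upd (a : ℤ) : ∀ (n : ℕ) (row : List ℤ) (rest : List (List ℤ)),
    row.length = n → Shp n rest → Shp n (upd a row rest)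
  | 0, [], rest, _, _ => by simp [upd, Shp]
  | n + 1, c :: cs, r :: rs, h, hs => by
      simp only [upd, Shp] at *
      refine ⟨?_, shp_upd a n cs rs (by simpa using h) hs.2⟩
      simp at h
      simp [hs.1, h]
  | n + 1, c :: cs, [], h, hs => by simp [Shp] at hs

theorem lin_zip (a c : ℤ) : ∀ (r cs : List ℤ) (xs : List X), r.length = cs.length →
    lin (List.zipWith (fun x y => a * x - c * y) r cs) xs
      = (a : ℝ) • lin r xs - (c : ℝ) • lin cs xs
  | [], [], xs, _ => by simp [lin]
  | _ :: _, _ :: _, [], _ => by simp [lin]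
  | r :: rs, c' :: cs, x :: xs, h => by
      simp only [List.zipWith, lin]
      rw [lin_zip a c rs cs xs (by simpa using h)]
      push_cast
      module

theorem evq_upd (B : LinearMap.BilinForm ℝ X) (hs : ∀ x y, B x y = B y x) (a : ℤ) :
    ∀ (n : ℕ) (row : List ℤ) (rest : List (List ℤ)) (xs : List X),
    row.length = n → Shp n rest → xs.length = n →
    evq B (upd a row rest) xs = a * evq B rest xs - B (lin row xs) (lin row xs)
  | 0, [], [], [], _, _, _ => by simp [upd, evq, lin]
  | 0, [], _ :: _, [], _, h2, _ => by simp [Shp] at h2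
  | n + 1, c :: cs, (d :: r) :: rs, x :: xs, h1, h2, h3 => by
      simp only [Shp] at h2
      have hl : r.length = cs.length := by
        have := h2.1; simp at this h1; omega
      simp only [upd, List.zipWith, evq, lin]
      rw [evq_upd B hs a n cs rs xs (by simpa using h1) h2.2 (by simpa using h3),
        lin_zip a c r cs xs hl]
      simp only [map_add, map_sub, map_smul, LinearMap.add_apply, LinearMap.smul_apply,
        smul_eq_mul, hs (lin cs xs) x]
      push_cast
      ring
  | n + 1, c :: cs, [] :: rs, x :: xs, h1, h2, h3 => by simp [Shp] at h2
  | n + 1, c :: cs, [], x :: xs, h1, h2, h3 => by simp [Shp] at h2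

theorem psd_sound (B : LinearMap.BilinForm ℝ X) (hs : ∀ x y, B x y = B y x)
    (hp : ∀ x, 0 ≤ B x x) : ∀ (n : ℕ) (rows : List (List ℤ)) (xs : List X),
    Shp n rows → xs.length = n → psd n rows = true → 0 ≤ evq B rows xs
  | 0, rows, [], h1, _, _ => by simp only [Shp] at h1; simp [h1, evq]
  | n + 1, (a :: row) :: rest, x :: xs, h1, h2, h3 => by
      simp only [Shp] at h1
      simp only [psd, Bool.and_eq_true, decide_eq_true_eq] at h3
      have hr : row.length = n := by have := h1.1; simpa using this
      have hx : xs.length = n := by simpa using h2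
      have ih := psd_sound B hs hp n _ xs (shp_upd a n row rest hr h1.2) hx h3.2
      rw [evq_upd B hs a n row rest xs hr h1.2 hx] at ih
      have ha : (0 : ℝ) < a := by exact_mod_cast h3.1
      have hq := hp ((a : ℝ) • x + lin row xs)
      simp only [map_add, map_smul, LinearMap.add_apply, LinearMap.smul_apply,
        smul_eq_mul, hs (lin row xs) x] at hq
      simp only [evq]
      by_contra hneg
      push Not at hneg
      have := mul_neg_of_pos_of_neg ha hneg
      nlinarith
  | n + 1, [] :: rest, x :: xs, h1, h2, h3 => by simp [Shp] at h1
  | n + 1, [], x :: xs, h1, h2, h3 => by simp [Shp] at h1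
end Sound

section Form
variable {E F : Type*} [NormedAddCommGroup E] [InnerProductSpace ℝ E]
  [NormedAddCommGroup F] [InnerProductSpace ℝ F]

open scoped RealInnerProductSpace

/-- the positive semidefinite form attached to a contraction -/
noncomputable def bil (M : E →ₗ[ℝ] F) : LinearMap.BilinForm ℝ (E × F) :=
  LinearMap.mk₂ ℝ (fun a b => ⟪a.1, b.1⟫ + ⟪a.2, b.2⟫ + ⟪M a.1, b.2⟫ + ⟪M b.1, a.2⟫)
    (by intros; simp only [Prod.fst_add, Prod.snd_add, map_add, inner_add_left, inner_add_right]; ring)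
    (by intros; simp only [Prod.smul_fst, Prod.smul_snd, map_smul, real_inner_smul_left,
      real_inner_smul_right, smul_eq_mul]; ring)
    (by intros; simp only [Prod.fst_add, Prod.snd_add, map_add, inner_add_left, inner_add_right]; ring)
    (by intros; simp only [Prod.smul_fst, Prod.smul_snd, map_smul, real_inner_smul_left,
      real_inner_smul_right, smul_eq_mul]; ring)

theorem bil_apply (M : E →ₗ[ℝ] F) (a b : E × F) :
    bil M a b = ⟪a.1, b.1⟫ + ⟪a.2, b.2⟫ + ⟪M a.1, b.2⟫ + ⟪M b.1, a.2⟫ := rfl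

theorem bil_symm (M : E →ₗ[ℝ] F) (a b : E × F) : bil M a b = bil M b a := by
  simp only [bil_apply]; rw [real_inner_comm a.2 b.2, real_inner_comm a.1 b.1]; ring

theorem inner_M_le (M : E →ₗ[ℝ] F) (hM : ∀ x, ‖M x‖ ≤ ‖x‖) (a : E) (b : F) :
    |⟪M a, b⟫| ≤ ‖a‖ * ‖b‖ :=
  (abs_real_inner_le_norm _ _).trans (mul_le_mul_of_nonneg_right (hM a) (norm_nonneg _))

theorem bil_nonneg (M : E →ₗ[ℝ] F) (hM : ∀ x, ‖M x‖ ≤ ‖x‖) (a : E × F) : 0 ≤ bil M a a := by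
  rw [bil_apply, real_inner_self_eq_norm_sq, real_inner_self_eq_norm_sq]
  have := (abs_le.mp (inner_M_le M hM a.1 a.2)).1
  nlinarith [sq_nonneg (‖a.1‖ - ‖a.2‖)]
end Form
end Nst
namespace Nst
section Chain
variable {E F : Type*} [NormedAddCommGroup E] [InnerProductSpace ℝ E]
  [NormedAddCommGroup F] [InnerProductSpace ℝ F]

open scoped RealInnerProductSpace

/-- normalized algorithm -/
structure Alg (C : Set E) (P : E → E) (M : E →ₗ[ℝ] F) (s : E) (N : ℕ) (W : ℕ → F)
    (g Gs z x u : ℕ → E) : Prop where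
  conv : Convex ℝ C
  pmem : ∀ y, P y ∈ C
  pvi : ∀ y, ∀ q ∈ C, ⟪y - P y, q - P y⟫ ≤ 0
  hg : ∀ k ≤ N, ∀ q, ⟪g k, q⟫ = ⟪s, q⟫ + ⟪M q, W k⟫
  hG0 : Gs 0 = (1 / 2 : ℝ) • g 0
  hG : ∀ k, k + 1 ≤ N → Gs (k + 1) = Gs k + (((k : ℝ) + 2) / 2) • g (k + 1)
  hu : ∀ k ≤ N, u k = P (x k - g k)
  hz : ∀ k ≤ N, z k = P (-Gs k)
  hx : ∀ k, k + 1 ≤ N →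
    x (k + 1) = (2 / ((k : ℝ) + 3)) • z k + (1 - 2 / ((k : ℝ) + 3)) • u k

/-- the linear model -/
noncomputable def ell (M : E →ₗ[ℝ] F) (s : E) (b w : F) (q : E) : ℝ := ⟪s, q⟫ + ⟪M q - b, w⟫

/-- weighted sum of the linear models -/
noncomputable def Lsum (M : E →ₗ[ℝ] F) (s : E) (b : F) (W : ℕ → F) : ℕ → E → ℝ
  | 0, q => 1 / 2 * ell M s b (W 0) q
  | k + 1, q => Lsum M s b W k q + ((k : ℝ) + 2) / 2 * ell M s b (W (k + 1)) q

/-- the extrapolated point -/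
noncomputable def yy (u z : ℕ → E) (k : ℕ) : E := u k + (2 / ((k : ℝ) + 2)) • (z k - u k)

/-- the remainder of the estimate sequence -/
noncomputable def Rem (M : E →ₗ[ℝ] F) (b : F) (W : ℕ → F) (z x u : ℕ → E) : ℕ → E → ℝ
  | 0, q => -‖q‖ ^ 2
  | k + 1, q => Rem M b W z x u k (z k)
      + ((k : ℝ) + 1) * ((k : ℝ) + 2) / 2 * (⟪u (k + 1) - x (k + 1), yy u z k - u (k + 1)⟫
        + ⟪M (yy u z k) - b, W (k + 1) - W k⟫) - ‖q - z k‖ ^ 2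

variable {C : Set E} {P : E → E} {M : E →ₗ[ℝ] F} {s : E} {N : ℕ} {W : ℕ → F}
    {g Gs z x u : ℕ → E} {b : F}

theorem Alg.umem (h : Alg C P M s N W g Gs z x u) {k : ℕ} (hk : k ≤ N) : u k ∈ C := by
  rw [h.hu k hk]; exact h.pmem _

theorem Alg.zmem (h : Alg C P M s N W g Gs z x u) {k : ℕ} (hk : k ≤ N) : z k ∈ C := by
  rw [h.hz k hk]; exact h.pmem _

theorem Alg.ymem (h : Alg C P M s N W g Gs z x u) {k : ℕ} (hk : k ≤ N) : yy u z k ∈ C := by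
  have h2 : (2 / ((k : ℝ) + 2)) ≤ 1 := by
    rw [div_le_one (by positivity)]; linarith [Nat.cast_nonneg (α := ℝ) k]
  exact h.conv.add_smul_sub_mem (h.umem hk) (h.zmem hk) ⟨by positivity, h2⟩

theorem ell_sub (w : F) (q q' : E) :
    ell M s b w q - ell M s b w q' = ⟪s, q - q'⟫ + ⟪M (q - q'), w⟫ := by
  simp only [ell, map_sub, inner_sub_left, inner_sub_right]; ring

theorem Alg.ell_le (h : Alg C P M s N W g Gs z x u) {k : ℕ} (hk : k ≤ N) {q : E} (hq : q ∈ C) :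
    ell M s b (W k) (u k) ≤ ell M s b (W k) q + ⟪u k - x k, q - u k⟫ := by
  have h1 := h.pvi (x k - g k) q hq
  rw [← h.hu k hk] at h1
  have h2 := h.hg k hk (q - u k)
  have h3 := ell_sub (M := M) (s := s) (b := b) (W k) q (u k)
  have h4 : ⟪x k - g k - u k, q - u k⟫ = -⟪u k - x k, q - u k⟫ - ⟪g k, q - u k⟫ := by
    simp only [inner_sub_left]; ring
  linarith

theorem Alg.Lsum_sub (h : Alg C P M s N W g Gs z x u) (q q' : E) : ∀ k ≤ N,
    Lsum M s b W k q - Lsum M s b W k q' = ⟪Gs k, q - q'⟫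
  | 0, hk => by
      simp only [Lsum]
      rw [← mul_sub, ell_sub, h.hG0, real_inner_smul_left, h.hg 0 hk]
  | k + 1, hk => by
      have ih := Alg.Lsum_sub h q q' k (by omega)
      simp only [Lsum]
      rw [h.hG k hk, inner_add_left, ← ih, real_inner_smul_left, h.hg _ hk, ← ell_sub (b := b)]
      ring

theorem Alg.ftrl (h : Alg C P M s N W g Gs z x u) {k : ℕ} (hk : k ≤ N) {q : E} (hq : q ∈ C) :
    2 * Lsum M s b W k (z k) + ‖z k‖ ^ 2 + ‖q - z k‖ ^ 2 ≤ 2 * Lsum M s b W k q + ‖q‖ ^ 2 := by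
  have h1 := h.pvi (-Gs k) q hq
  rw [← h.hz k hk] at h1
  have h2 := h.Lsum_sub (b := b) q (z k) k hk
  have h4 : ⟪-Gs k - z k, q - z k⟫ = -⟪Gs k, q - z k⟫ - ⟪z k, q - z k⟫ := by
    simp only [inner_sub_left, inner_neg_left]
  have h5 : ‖q‖ ^ 2 = ‖z k‖ ^ 2 + 2 * ⟪z k, q - z k⟫ + ‖q - z k‖ ^ 2 := by
    rw [← norm_add_sq_real]; congr 2; abel
  linarith

theorem ell_affine (w : F) (p q : E) (t : ℝ) :
    ell M s b w (p + t • (q - p)) = (1 - t) * ell M s b w p + t * ell M s b w q := by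
  simp only [ell, map_sub, map_add, map_smul, inner_sub_left, inner_sub_right, inner_add_left,
    inner_add_right, real_inner_smul_left, real_inner_smul_right]; ring

theorem Alg.claim (h : Alg C P M s N W g Gs z x u) : ∀ k ≤ N, ∀ q ∈ C,
    2 * (((k : ℝ) * (k + 1) / 4) * ell M s b (W k) (u k) + ((k : ℝ) + 1) / 2 * ell M s b (W k) q)
      ≤ 2 * Lsum M s b W k q + ‖q‖ ^ 2 + Rem M b W z x u k q
  | 0, _, q, _ => by simp [Lsum, Rem]
  | k + 1, hk, q, hq => by
      have ih := Alg.claim h k (by omega) (z k) (h.zmem (by omega))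
      have h1 := h.ftrl (b := b) (k := k) (by omega) hq
      have h2 := h.ell_le (b := b) hk (h.ymem (k := k) (by omega))
      have h3 : ((k : ℝ) + 1) * ((k : ℝ) + 2) / 4 * ell M s b (W k) (yy u z k)
          = ((k : ℝ) * (k + 1) / 4) * ell M s b (W k) (u k)
            + ((k : ℝ) + 1) / 2 * ell M s b (W k) (z k) := by
        rw [yy, ell_affine]
        have : (k : ℝ) + 2 ≠ 0 := by positivity
        field_simp
        ring
      have h4 : ell M s b (W (k + 1)) (yy u z k) = ell M s b (W k) (yy u z k)
          + ⟪M (yy u z k) - b, W (k + 1) - W k⟫ := by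
        simp only [ell, inner_sub_right]; ring
      have h5 := mul_le_mul_of_nonneg_left h2
        (show (0 : ℝ) ≤ ((k : ℝ) + 1) * ((k : ℝ) + 2) / 2 by positivity)
      rw [h4] at h5
      simp only [Lsum, Rem]
      push_cast
      linarith

theorem Alg.final (h : Alg C P M s N W g Gs z x u) {p : E} (hp : p ∈ C) :
    2 * (((N : ℝ) + 1) * (N + 2) / 4 * ell M s b (W N) (u N))
      ≤ 2 * Lsum M s b W N p + ‖p‖ ^ 2 + Rem M b W z x u N p
        + ((N : ℝ) + 1) * ⟪u N - x N, p - u N⟫ := by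
  have h1 := h.claim (b := b) N le_rfl p hp
  have h2 := h.ell_le (b := b) le_rfl hp
  have h3 := mul_le_mul_of_nonneg_left h2 (show (0 : ℝ) ≤ (N : ℝ) + 1 by positivity)
  linarith

/-- monotonicity of the projection along the iterates -/
theorem Alg.mono (h : Alg C P M s N W g Gs z x u) {k : ℕ} (hk : k + 1 ≤ N) :
    ⟪(u (k + 1) - x (k + 1)) - (u k - x k), u (k + 1) - u k⟫
      + ⟪M (u (k + 1) - u k), W (k + 1) - W k⟫ ≤ 0 := by
  have h1 := h.pvi (x k - g k) _ (h.umem hk)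
  have h2 := h.pvi (x (k + 1) - g (k + 1)) _ (h.umem (k := k) (by omega))
  rw [← h.hu k (by omega)] at h1
  rw [← h.hu _ hk] at h2
  have h3 := h.hg k (by omega) (u (k + 1) - u k)
  have h4 := h.hg _ hk (u (k + 1) - u k)
  have h5 : ⟪x (k + 1) - g (k + 1) - u (k + 1), u k - u (k + 1)⟫
    = -⟪x (k + 1) - u (k + 1), u (k + 1) - u k⟫ + ⟪g (k + 1), u (k + 1) - u k⟫ := by
    rw [← neg_sub (u (k + 1)) (u k), inner_neg_right, sub_right_comm, inner_sub_left]; ring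
  have h6 : ⟪x k - g k - u k, u (k + 1) - u k⟫
    = ⟪x k - u k, u (k + 1) - u k⟫ - ⟪g k, u (k + 1) - u k⟫ := by
    rw [sub_right_comm, inner_sub_left]
  rw [inner_sub_left, ← neg_sub (x k), ← neg_sub (x (k + 1)), inner_neg_left, inner_neg_left,
    inner_sub_right _ (W (k + 1)) (W k)]
  linarith

end Chain
end Nst
namespace Nst

/-- state of the certificate -/
structure St where
  rr : ℤ
  rh : ℤ
  rW : ℤ
  hh : ℤ
  hW : ℤ
  WW : ℤ

/-- scaled weight -/
def sA (k : ℕ) : ℤ := ((k : ℤ) + 1) * ((k : ℤ) + 2) * 1000000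

/-- scaled multiplier -/
def sB (b0 t : ℤ) (k : ℕ) : ℤ := if sA k - t < b0 then b0 else sA k - t

/-- the step form -/
def stepRows (k : ℕ) (b : ℤ) (P Q : St) : List (List ℤ) :=
  let y : ℤ := (k : ℤ) + 1
  let K : ℤ := (k : ℤ) + 4
  let A : ℤ := sA k
  let Z : ℤ := y * ((k : ℤ) + 3) * 2000000
  [[P.rr, P.rh - 2 * b, P.rW + A, 0, -b, -A],
   [P.hh + y * y * 4000000, P.hW + Z - 2 * b, -(y * K * 4000000), 2 * b - y * 6000000, 2 * b - Z],
   [P.WW + A + y * 2000000, 0, -b, -A],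
   [K * K * 4000000 - Q.hh, K * 4000000 - Q.rh, -Q.hW],
   [2 * A + 2 * b + 4000000 - Q.rr, b - Q.rW],
   [A - Q.WW]]

/-- the final form -/
def finRows (k : ℕ) (lv : ℤ) (P : St) : List (List ℤ) :=
  let y : ℤ := (k : ℤ) + 1
  let A : ℤ := sA k
  [[P.rr, P.rh - y * ((k : ℤ) + 3) * 2000000, P.rW + A, -A],
   [P.hh, P.hW, 0],
   [P.WW + A + y * 2000000, -A],
   [lv]]

/-- proposal for the next state -/
def next (k : ℕ) (b : ℤ) (P : St) : St :=
  match stepRows k b P ⟨0, 0, 0, 0, 0, 0⟩ with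
  | (a :: row) :: rest =>
    match upd a row rest with
    | (a2 :: row2) :: rest2 =>
      match upd a2 row2 rest2 with
      | (a3 :: row3) :: rest3 =>
        match upd a3 row3 rest3 with
        | [[hh, rh, hW], [rr, rW], [WW]] =>
          let p := a * a2 * a3
          ⟨rr / p - 3, rh / p, rW / p, hh / p - 3, hW / p, WW / p - 3⟩
        | _ => ⟨0, 0, 0, 0, 0, 0⟩
      | _ => ⟨0, 0, 0, 0, 0, 0⟩
    | _ => ⟨0, 0, 0, 0, 0, 0⟩
  | _ => ⟨0, 0, 0, 0, 0, 0⟩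

/-- the multiplier left for the last dual iterate -/
def lvOf (k : ℕ) (lx sl : ℤ) : ℤ :=
  ((k : ℤ) + 1) * ((k : ℤ) + 1) * (4000000 - lx) / 4 + ((k : ℤ) + 1) * 2000000 - sl

section PartA
variable {E F : Type*} [NormedAddCommGroup E] [InnerProductSpace ℝ E]
  [NormedAddCommGroup F] [InnerProductSpace ℝ F]

open scoped RealInnerProductSpace

/-- value of the state form -/
noncomputable def Pev (M : E →ₗ[ℝ] F) (P : St) (r h : E) (w : F) : ℝ :=
  P.rr * ⟪r, r⟫ + 2 * P.rh * ⟪r, h⟫ + 2 * P.rW * ⟪M r, w⟫ + P.hh * ⟪h, h⟫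
    + 2 * P.hW * ⟪M h, w⟫ + P.WW * ⟪w, w⟫

theorem evq_step (M : E →ₗ[ℝ] F) (k : ℕ) (b : ℤ) (P Q : St) (r h r1 h1 : E) (w w1 : F) :
    evq (bil M) (stepRows k b P Q) [(r, 0), (h, 0), (0, w), (h1, 0), (r1, 0), (0, w1)]
    = Pev M P r h w - Pev M Q r1 h1 w1
      - 2000000 * ((k : ℝ) + 1) * (⟪r1, (2 * ((k : ℝ) + 3)) • h - ((k : ℝ) + 2) • (r1 + (2 : ℝ) • h)⟫
          + ⟪M (((k : ℝ) + 2) • r + (2 * ((k : ℝ) + 3)) • h), w1 - w⟫)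
      + 4000000 * ⟪((k : ℝ) + 4) • h1 + r1 - ((k : ℝ) + 1) • h,
          ((k : ℝ) + 4) • h1 + r1 - ((k : ℝ) + 1) • h⟫
      - 1000000 * ((k : ℝ) + 1) * ((k : ℝ) + 2) * (⟪w1, w1⟫ - ⟪w, w⟫ - ⟪w1 - w, w1 - w⟫)
      + 1000000 * ((k : ℝ) + 1) * ((k : ℝ) + 2) * ⟪w1, w1⟫
      - 1000000 * (k : ℝ) * ((k : ℝ) + 1) * ⟪w, w⟫
      + 2 * b * (⟪r1 - r, r1 + (2 : ℝ) • h⟫ + ⟪M (r1 + (2 : ℝ) • h), w1 - w⟫) := by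
  simp only [evq, stepRows, lin, bil_apply, Pev, sA, Prod.fst_add, Prod.snd_add, Prod.smul_fst,
    Prod.smul_snd, Prod.fst_zero, Prod.snd_zero,
    map_add, map_sub, map_smul, map_zero, inner_add_left, inner_add_right, inner_sub_left,
    inner_sub_right, real_inner_smul_left, real_inner_smul_right, inner_zero_left,
    inner_zero_right, smul_eq_mul]
  rw [real_inner_comm h r1, real_inner_comm h h1, real_inner_comm h1 r1, real_inner_comm w w1]
  push_cast
  ring

theorem evq_fin (M : E →ₗ[ℝ] F) (k : ℕ) (lv : ℤ) (P : St) (r h : E) (w w1 : F) :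
    evq (bil M) (finRows k lv P) [(r, 0), (h, 0), (0, w), (0, w1)]
    = Pev M P r h w + lv * ⟪w1, w1⟫
      - 4000000 * ((k : ℝ) + 1) * ((k : ℝ) + 3) * ⟪r, h⟫
      - 2000000 * ((k : ℝ) + 1) * ((k : ℝ) + 2) * ⟪M r, w1 - w⟫
      - 1000000 * ((k : ℝ) + 1) * ((k : ℝ) + 2) * (⟪w1, w1⟫ - ⟪w, w⟫ - ⟪w1 - w, w1 - w⟫)
      - 1000000 * (k : ℝ) * ((k : ℝ) + 1) * ⟪w, w⟫ := by
  simp only [evq, finRows, lin, bil_apply, Pev, sA, Prod.fst_add, Prod.snd_add, Prod.smul_fst,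
    Prod.smul_snd, Prod.fst_zero, Prod.snd_zero,
    map_add, map_sub, map_smul, map_zero, inner_add_left, inner_add_right, inner_sub_left,
    inner_sub_right, real_inner_smul_left, real_inner_smul_right, inner_zero_left,
    inner_zero_right, smul_eq_mul]
  rw [real_inner_comm w w1]
  push_cast
  ring
end PartA
end Nst
namespace Nst
section PartA2
variable {E F : Type*} [NormedAddCommGroup E] [InnerProductSpace ℝ E]
  [NormedAddCommGroup F] [InnerProductSpace ℝ F]

open scoped RealInnerProductSpace

/-- validity of a certificate state -/
def Vld (M : E →ₗ[ℝ] F) (b : F) (W : ℕ → F) (z x u : ℕ → E) (k : ℕ) (P : St) (K : ℝ) : Prop :=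
  ∀ q, 4000000 * Rem M b W z x u k q ≤
    -Pev M P (u k - x k) ((1 / ((k : ℝ) + 3)) • (q - u k)) (W k)
      + 1000000 * (k : ℝ) * ((k : ℝ) + 1) * ⟪W k, W k⟫ + K

/-- adding a multiple of the norm of the dual iterate -/
def St.add (P : St) (l : ℤ) : St := ⟨P.rr, P.rh, P.rW, P.hh, P.hW, P.WW + l⟩

theorem Pev_add (M : E →ₗ[ℝ] F) (P : St) (l : ℤ) (r h : E) (w : F) :
    Pev M (P.add l) r h w = Pev M P r h w + l * ⟪w, w⟫ := by
  simp only [Pev, St.add]; push_cast; ring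

variable {C : Set E} {P : E → E} {M : E →ₗ[ℝ] F} {s : E} {N : ℕ} {W : ℕ → F}
    {g Gs z x u : ℕ → E} {b : F}

theorem vld_step (h : Alg C P M s N W g Gs z x u) (hM : ∀ x, ‖M x‖ ≤ ‖x‖)
    {k : ℕ} (hk : k + 1 ≤ N)
    (hVI : 2 * ⟪M (x k) - b, W (k + 1) - W k⟫
      ≤ ⟪W (k + 1), W (k + 1)⟫ - ⟪W k, W k⟫ - ⟪W (k + 1) - W k, W (k + 1) - W k⟫)
    {m : ℝ} (hW : ⟪W (k + 1), W (k + 1)⟫ ≤ m) {Pk Q : St} {K : ℝ} (bt l : ℤ)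
    (hb : 0 ≤ bt) (hl : 0 ≤ l) (hp : psd 6 (stepRows k bt Pk Q) = true)
    (hv : Vld M b W z x u k Pk K) : Vld M b W z x u (k + 1) (Q.add l) (K + l * m) := by
  intro q
  have hk3 : (k : ℝ) + 3 ≠ 0 := by positivity
  have hk2 : (k : ℝ) + 2 ≠ 0 := by positivity
  have hk4 : (k : ℝ) + 1 + 3 ≠ 0 := by positivity
  set H := (1 / ((k : ℝ) + 3)) • (z k - u k) with hH
  push_cast
  set h1 := (1 / ((k : ℝ) + 1 + 3)) • (q - u (k + 1)) with hh1
  set r1 := u (k + 1) - x (k + 1) with hr1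
  set r := u k - x k with hr
  have hxk := h.hx k hk
  have hzu : z k = u k + ((k : ℝ) + 3) • H := by
    rw [hH, smul_smul, mul_one_div_cancel hk3]; module
  have hqu : q = u (k + 1) + ((k : ℝ) + 4) • h1 := by
    rw [hh1, smul_smul, show ((k : ℝ) + 4) * (1 / ((k : ℝ) + 1 + 3)) = 1 by
      field_simp; ring]; module
  have e0 : x (k + 1) = u k + (2 : ℝ) • H := by
    rw [hxk, hzu, smul_add, smul_smul, show 2 / ((k : ℝ) + 3) * (k + 3) = 2 by field_simp]; module
  have e1 : u (k + 1) - u k = r1 + (2 : ℝ) • H := by rw [hr1, e0]; module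
  have ey : yy u z k = u k + (2 * ((k : ℝ) + 3) / ((k : ℝ) + 2)) • H := by
    rw [yy, hzu, add_sub_cancel_left, smul_smul]; congr 2; ring
  have e2 : ((k : ℝ) + 2) • (yy u z k - u (k + 1))
      = (2 * ((k : ℝ) + 3)) • H - ((k : ℝ) + 2) • (r1 + (2 : ℝ) • H) := by
    rw [← e1, ey, add_sub_right_comm, smul_add, smul_smul, mul_div_cancel₀ _ hk2]; module
  have e3 : q - z k = ((k : ℝ) + 4) • h1 + r1 - ((k : ℝ) + 1) • H := by
    have : u (k + 1) = u k + (r1 + (2 : ℝ) • H) := by rw [← e1]; abel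
    rw [hzu]; nth_rewrite 1 [hqu]; rw [this]; module
  have e4 : ((k : ℝ) + 2) • (M (yy u z k) - b)
      = ((k : ℝ) + 2) • (M (x k) - b) + M (((k : ℝ) + 2) • r + (2 * ((k : ℝ) + 3)) • H) := by
    have : ((k : ℝ) + 2) • yy u z k = ((k : ℝ) + 2) • x k
        + (((k : ℝ) + 2) • r + (2 * ((k : ℝ) + 3)) • H) := by
      rw [ey, smul_add, smul_smul, mul_div_cancel₀ _ hk2, hr]; module
    rw [smul_sub, ← map_smul, this, map_add, map_smul, smul_sub]; generalize M _ = m1; module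
  have f2 : ((k : ℝ) + 2) * ⟪r1, yy u z k - u (k + 1)⟫
      = ⟪r1, (2 * ((k : ℝ) + 3)) • H - ((k : ℝ) + 2) • (r1 + (2 : ℝ) • H)⟫ := by
    rw [← e2, real_inner_smul_right]
  have f4 : ((k : ℝ) + 2) * ⟪M (yy u z k) - b, W (k + 1) - W k⟫
      = ((k : ℝ) + 2) * ⟪M (x k) - b, W (k + 1) - W k⟫
        + ⟪M (((k : ℝ) + 2) • r + (2 * ((k : ℝ) + 3)) • H), W (k + 1) - W k⟫ := by
    rw [← real_inner_smul_left, e4, inner_add_left, real_inner_smul_left]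
  have hmono := h.mono hk
  rw [e1] at hmono
  have hps := psd_sound (bil M) (bil_symm M) (bil_nonneg M hM) 6 (stepRows k bt Pk Q)
    [(r, 0), (H, 0), (0, W k), (h1, 0), (r1, 0), (0, W (k + 1))]
    (by simp [stepRows, Shp]) rfl hp
  rw [evq_step] at hps
  have hv1 := hv (z k)
  rw [← hH, ← hr] at hv1
  rw [Pev_add]
  simp only [Rem]
  rw [← real_inner_self_eq_norm_sq (q - z k), e3]
  have hbr : (0 : ℝ) ≤ bt := by exact_mod_cast hb
  have hlr : (0 : ℝ) ≤ l := by exact_mod_cast hl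
  have g1 := mul_le_mul_of_nonneg_left hVI
    (show (0 : ℝ) ≤ 1000000 * ((k : ℝ) + 1) * ((k : ℝ) + 2) by positivity)
  have g2 := mul_nonpos_of_nonneg_of_nonpos hbr hmono
  have g3 := mul_le_mul_of_nonneg_left hW hlr
  have g4 : ((k : ℝ) + 1) * ((k : ℝ) + 2) / 2 * (⟪r1, yy u z k - u (k + 1)⟫
        + ⟪M (yy u z k) - b, W (k + 1) - W k⟫) = ((k : ℝ) + 1) / 2 *
        (⟪r1, (2 * ((k : ℝ) + 3)) • H - ((k : ℝ) + 2) • (r1 + (2 : ℝ) • H)⟫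
        + (((k : ℝ) + 2) * ⟪M (x k) - b, W (k + 1) - W k⟫
        + ⟪M (((k : ℝ) + 2) • r + (2 * ((k : ℝ) + 3)) • H), W (k + 1) - W k⟫)) := by
    rw [← f2, ← f4]; ring
  rw [← hr1, g4]
  linarith

theorem vld_fin (h : Alg C P M s N W g Gs z x u) (hM : ∀ x, ‖M x‖ ≤ ‖x‖)
    (hVI : 2 * ⟪M (x N) - b, W (N + 1) - W N⟫
      ≤ ⟪W (N + 1), W (N + 1)⟫ - ⟪W N, W N⟫ - ⟪W (N + 1) - W N, W (N + 1) - W N⟫)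
    {m : ℝ} (hW : ⟪W (N + 1), W (N + 1)⟫ ≤ m) {Pk : St} {K : ℝ} (lv : ℤ)
    (hl : 0 ≤ lv) (hp : psd 4 (finRows N lv Pk) = true)
    (hv : Vld M b W z x u N Pk K) {p : E} (hp1 : p ∈ C) (hp2 : ‖p‖ ≤ 1) :
    4000000 * (2 * (((N : ℝ) + 1) * (N + 2) / 4 * ell M s b (W (N + 1)) (u N))
      - 2 * Lsum M s b W N p) ≤ 4000000 + K + lv * m := by
  have hf := h.final (b := b) hp1
  have hv1 := hv p
  have hk3 : (N : ℝ) + 3 ≠ 0 := by positivity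
  set H := (1 / ((N : ℝ) + 3)) • (p - u N) with hH
  set r := u N - x N with hr
  have hzu : p - u N = ((N : ℝ) + 3) • H := by
    rw [hH, smul_smul, mul_one_div_cancel hk3]; module
  rw [hzu, real_inner_smul_right] at hf
  have hps := psd_sound (bil M) (bil_symm M) (bil_nonneg M hM) 4 (finRows N lv Pk)
    [(r, 0), (H, 0), (0, W N), (0, W (N + 1))]
    (by simp [finRows, Shp]) rfl hp
  rw [evq_fin] at hps
  have h4 : ell M s b (W (N + 1)) (u N) = ell M s b (W N) (u N)
      + ⟪M (x N) - b, W (N + 1) - W N⟫ + ⟪M r, W (N + 1) - W N⟫ := by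
    simp only [ell, hr, map_sub, inner_sub_right, inner_sub_left]; ring
  have hlr : (0 : ℝ) ≤ lv := by exact_mod_cast hl
  have g1 := mul_le_mul_of_nonneg_left hVI
    (show (0 : ℝ) ≤ 1000000 * ((N : ℝ) + 1) * ((N : ℝ) + 2) by positivity)
  have g3 := mul_le_mul_of_nonneg_left hW hlr
  have g5 : ‖p‖ ^ 2 ≤ 1 := by nlinarith [norm_nonneg p]
  rw [h4]
  linarith

theorem vld_zero (q lx l : ℤ) (hq : 0 ≤ q) (hlx : 0 < lx) (hql : q * (4000000 + lx) ≤ lx * 4000000)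
    (hl : 0 ≤ l) (hx0 : ‖x 0‖ ≤ 1) {m : ℝ} (hW : ⟪W 0, W 0⟫ ≤ m) :
    Vld M b W z x u 0 ⟨q, 3 * q, 0, 9 * q, 0, l⟩ (lx + l * m) := by
  intro p
  have hp : p = (u 0 - x 0) + (3 : ℝ) • ((1 / (((0 : ℕ) : ℝ) + 3)) • (p - u 0)) + x 0 := by
    rw [smul_smul]; norm_num
  set H := (1 / (((0 : ℕ) : ℝ) + 3)) • (p - u 0)
  set r := u 0 - x 0
  have hqr : (0 : ℝ) ≤ q := by exact_mod_cast hq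
  have hlr : (0 : ℝ) ≤ l := by exact_mod_cast hl
  have hlxr : (0 : ℝ) < lx := by exact_mod_cast hlx
  have hqlr : (q : ℝ) * (4000000 + lx) ≤ lx * 4000000 := by exact_mod_cast hql
  have g3 := mul_le_mul_of_nonneg_left hW hlr
  have h1 : ‖x 0‖ ^ 2 ≤ 1 := by nlinarith [norm_nonneg (x 0)]
  set t := r + (3 : ℝ) • H with ht
  have h2 : (q : ℝ) * ‖t‖ ^ 2 = q * ⟪r, r⟫ + 6 * q * ⟪r, H⟫ + 9 * q * ⟪H, H⟫ := by
    rw [← real_inner_self_eq_norm_sq, ht]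
    simp only [inner_add_left, inner_add_right, real_inner_smul_left, real_inner_smul_right]
    rw [real_inner_comm r H]; ring
  have h3 : ‖t‖ ^ 2 * q ≤ 4000000 * ‖p‖ ^ 2 + lx * ‖x 0‖ ^ 2 := by
    have h5 : ‖p‖ ^ 2 = ‖t‖ ^ 2 + 2 * ⟪t, x 0⟫ + ‖x 0‖ ^ 2 := by
      rw [← norm_add_sq_real, ← hp]
    have h6 := (abs_le.mp (abs_real_inner_le_norm t (x 0))).1
    have h7 : (q : ℝ) ≤ lx * 4000000 / (4000000 + lx) := by
      rw [le_div_iff₀ (by positivity)]; exact hqlr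
    have h8 := mul_le_mul_of_nonneg_left h7 (sq_nonneg ‖t‖)
    have h9 : ‖t‖ ^ 2 * (lx * 4000000 / (4000000 + lx)) ≤
        4000000 * (‖t‖ ^ 2 - 2 * (‖t‖ * ‖x 0‖) + ‖x 0‖ ^ 2) + lx * ‖x 0‖ ^ 2 := by
      rw [← mul_div_assoc, div_le_iff₀ (by positivity)]
      nlinarith [sq_nonneg (4000000 * ‖t‖ - (4000000 + lx) * ‖x 0‖)]
    rw [h5]; nlinarith
  simp only [Rem, Pev]
  push_cast
  nlinarith

/-- run the certificate for `n` steps, testing the final form from index `a` on -/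
def cert (b0 t : ℤ) (lam : List ℤ) (sl lx : ℤ) (a : ℕ) : ℕ → ℕ → St → Option St
  | 0, _, P => some P
  | n + 1, k, P =>
    if (Nat.ble a k && !(decide (0 ≤ lvOf k lx sl) && psd 4 (finRows k (lvOf k lx sl) P)))
    then none else
    let Q := next k (sB b0 t k) P
    if psd 6 (stepRows k (sB b0 t k) P Q) then
      cert b0 t lam sl lx a n (k + 1) (Q.add (lam.getD (k + 1) 0))
    else none

/-- comparison of states -/
def St.eqb (P Q : St) : Bool :=
  decide (P.rr = Q.rr) && decide (P.rh = Q.rh) && decide (P.rW = Q.rW) && decide (P.hh = Q.hh)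
    && decide (P.hW = Q.hW) && decide (P.WW = Q.WW)

theorem St.eq_of_eqb {P Q : St} (h : P.eqb Q = true) : P = Q := by
  cases P; cases Q
  simp only [St.eqb, Bool.and_eq_true, decide_eq_true_eq] at h
  simp only [St.mk.injEq]
  tauto

/-- certificate between two checkpoints -/
def certTo (b0 t : ℤ) (lam : List ℤ) (sl lx : ℤ) (a n k : ℕ) (P Q : St) : Bool :=
  match cert b0 t lam sl lx a n k P with
  | some Q' => Q'.eqb Q
  | none => false

/-- certificate without a checkpoint at the end -/
def certAll (b0 t : ℤ) (lam : List ℤ) (sl lx : ℤ) (a n k : ℕ) (P : St) : Bool :=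
  match cert b0 t lam sl lx a n k P with
  | some _ => true
  | none => false

theorem sB_nonneg {b0 : ℤ} (h : 0 ≤ b0) (t : ℤ) (k : ℕ) : 0 ≤ sB b0 t k := by
  unfold sB; split_ifs with h1 <;> linarith

theorem take_sum_le : ∀ (lam : List ℤ) (k : ℕ), (∀ l ∈ lam, 0 ≤ l) → (lam.take k).sum ≤ lam.sum
  | [], k, _ => by simp
  | a :: as, 0, h => by
      simp only [List.take_zero, List.sum_nil]; exact List.sum_nonneg h
  | a :: as, k + 1, h => by
      simp only [List.take_succ_cons, List.sum_cons]
      have := take_sum_le as k (fun l hl => h l (List.mem_cons_of_mem _ hl))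
      linarith

theorem take_sum_succ : ∀ (lam : List ℤ) (k : ℕ),
    (lam.take (k + 1)).sum = (lam.take k).sum + lam.getD k 0
  | [], k => by simp
  | a :: as, 0 => by simp
  | a :: as, k + 1 => by
      have := take_sum_succ as k
      simp only [List.take_succ_cons, List.sum_cons, List.getD_cons_succ] at *
      linarith

theorem getD_nonneg (lam : List ℤ) (k : ℕ) (h : ∀ l ∈ lam, 0 ≤ l) : 0 ≤ lam.getD k 0 := by
  by_cases hk : k < lam.length
  · rw [List.getD_eq_getElem _ _ hk]; exact h _ (List.getElem_mem hk)
  · rw [List.getD_eq_default _ _ (by omega)]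

theorem cert_sound (h : Alg C P M s N W g Gs z x u) (hM : ∀ x, ‖M x‖ ≤ ‖x‖)
    (hVI : ∀ k ≤ N, 2 * ⟪M (x k) - b, W (k + 1) - W k⟫
      ≤ ⟪W (k + 1), W (k + 1)⟫ - ⟪W k, W k⟫ - ⟪W (k + 1) - W k, W (k + 1) - W k⟫)
    {m : ℝ} (hW : ∀ k ≤ N + 1, ⟪W k, W k⟫ ≤ m)
    {b0 t : ℤ} {lam : List ℤ} {sl lx : ℤ} {a : ℕ} (hb0 : 0 ≤ b0) (hlam : ∀ l ∈ lam, 0 ≤ l) :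
    ∀ (n k : ℕ) (Pk Q : St), cert b0 t lam sl lx a n k Pk = some Q → k ≤ N →
    Vld M b W z x u k Pk (lx + (lam.take (k + 1)).sum * m) →
    (k + n ≤ N → Vld M b W z x u (k + n) Q (lx + (lam.take (k + n + 1)).sum * m)) ∧
    (a ≤ N → N < k + n → ∃ P', Vld M b W z x u N P' (lx + (lam.take (N + 1)).sum * m) ∧
      0 ≤ lvOf N lx sl ∧ psd 4 (finRows N (lvOf N lx sl) P') = true)
  | 0, k, Pk, Q, hc, hk, hv => by
      simp only [cert, Option.some.injEq] at hc
      subst hc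
      exact ⟨fun _ => hv, fun _ h2 => by omega⟩
  | n + 1, k, Pk, Q, hc, hk, hv => by
      simp only [cert] at hc
      split_ifs at hc with h1 h2
      rcases Nat.lt_or_ge k N with hkN | hkN
      · have hs := vld_step h hM (k := k) hkN (hVI k hk) (hW (k + 1) (by omega))
          _ (lam.getD (k + 1) 0) (sB_nonneg hb0 t k) (getD_nonneg _ _ hlam) h2 hv
        have e : (lx : ℝ) + (lam.take (k + 1)).sum * m + (lam.getD (k + 1) 0 : ℤ) * m
            = lx + (lam.take (k + 1 + 1)).sum * m := by
          rw [take_sum_succ lam (k + 1)]; push_cast; ring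
        rw [e] at hs
        have ih := cert_sound h hM hVI hW hb0 hlam n (k + 1) _ Q hc hkN hs
        rw [show k + (n + 1) = k + 1 + n by ring]
        exact ih
      · have hkN' : k = N := by omega
        subst hkN'
        refine ⟨fun hh => by omega, fun ha _ => ⟨Pk, hv, ?_⟩⟩
        have : Nat.ble a k = true := Nat.ble_eq.mpr ha
        simp only [this, Bool.true_and, Bool.not_eq_true', Bool.not_eq_false, Bool.and_eq_true,
          decide_eq_true_eq] at h1
        exact h1

theorem fin_bound (h : Alg C P M s N W g Gs z x u) (hM : ∀ x, ‖M x‖ ≤ ‖x‖)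
    (hVI : ∀ k ≤ N, 2 * ⟪M (x k) - b, W (k + 1) - W k⟫
      ≤ ⟪W (k + 1), W (k + 1)⟫ - ⟪W k, W k⟫ - ⟪W (k + 1) - W k, W (k + 1) - W k⟫)
    (hW : ∀ k ≤ N + 1, ⟪W k, W k⟫ ≤ 4 / ((N : ℝ) + 1) ^ 2)
    {lam : List ℤ} {lx : ℤ} (hlam : ∀ l ∈ lam, 0 ≤ l)
    (hP : ∃ P', Vld M b W z x u N P' (lx + (lam.take (N + 1)).sum * (4 / ((N : ℝ) + 1) ^ 2)) ∧
      0 ≤ lvOf N lx lam.sum ∧ psd 4 (finRows N (lvOf N lx lam.sum) P') = true)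
    {p : E} (hp1 : p ∈ C) (hp2 : ‖p‖ ≤ 1) :
    2 * (((N : ℝ) + 1) * (N + 2) / 4 * ell M s b (W (N + 1)) (u N))
      - 2 * Lsum M s b W N p ≤ 2 + 2 / ((N : ℝ) + 1) := by
  obtain ⟨P', hv, hl, hps⟩ := hP
  have hf := vld_fin h hM (hVI N le_rfl) (hW (N + 1) le_rfl) _ hl hps hv hp1 hp2
  have h1 : ((lam.take (N + 1)).sum : ℝ) ≤ (lam.sum : ℤ) := by
    exact_mod_cast take_sum_le lam (N + 1) hlam
  have h2 : (lvOf N lx lam.sum : ℝ) ≤ ((N : ℝ) + 1) * ((N : ℝ) + 1) * (4000000 - lx) / 4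
      + ((N : ℝ) + 1) * 2000000 - (lam.sum : ℤ) := by
    have h3 : (4 : ℤ) * lvOf N lx lam.sum ≤ ((N : ℤ) + 1) * ((N : ℤ) + 1) * (4000000 - lx)
        + 4 * (((N : ℤ) + 1) * 2000000) - 4 * lam.sum := by
      unfold lvOf
      have := Int.mul_ediv_self_le (x := ((N : ℤ) + 1) * ((N : ℤ) + 1) * (4000000 - lx))
        (k := 4) (by norm_num)
      linarith
    have h4 : (4 : ℝ) * lvOf N lx lam.sum ≤ ((N : ℝ) + 1) * ((N : ℝ) + 1) * (4000000 - lx)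
        + 4 * (((N : ℝ) + 1) * 2000000) - 4 * (lam.sum : ℤ) := by exact_mod_cast h3
    linarith
  have hm : (0 : ℝ) ≤ 4 / ((N : ℝ) + 1) ^ 2 := by positivity
  have h5 := mul_le_mul_of_nonneg_right h1 hm
  have h6 := mul_le_mul_of_nonneg_right h2 hm
  have h7 : (((N : ℝ) + 1) * ((N : ℝ) + 1) * (4000000 - lx) / 4
      + ((N : ℝ) + 1) * 2000000 - (lam.sum : ℤ)) * (4 / ((N : ℝ) + 1) ^ 2)
      = 4000000 - lx + 4000000 * (2 / ((N : ℝ) + 1))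
        - (lam.sum : ℤ) * (4 / ((N : ℝ) + 1) ^ 2) := by
    have : (N : ℝ) + 1 ≠ 0 := by positivity
    field_simp
    ring
  linarith
end PartA2
end Nst
namespace Nst
set_option maxRecDepth 100000
theorem c4_0 : certTo 156000 6294400 [90613600, 23765200, 22047200, 167200] 136593200 187196 56 100 0
    ⟨178827, 536481, 0, 1609443, 0, 90613600⟩
    ⟨22232248306, 20050703992, 1367058979, 1081990731, -235323843, 1254749176⟩ = true := by
  decide +kernel

theorem c4_1 : certTo 156000 6294400 [90613600, 23765200, 22047200, 167200] 136593200 187196 56 100 100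
    ⟨22232248306, 20050703992, 1367058979, 1081990731, -235323843, 1254749176⟩
    ⟨85613791105, 80138463797, 3892060329, 2081389203, -447353199, 3673366490⟩ = true := by
  decide +kernel

theorem c4_2 : certTo 156000 6294400 [90613600, 23765200, 22047200, 167200] 136593200 187196 56 100 200
    ⟨85613791105, 80138463797, 3892060329, 2081389203, -447353199, 3673366490⟩
    ⟨189752699036, 180229285806, 7176189327, 3081158997, -656475371, 6852762561⟩ = true := by
  decide +kernel

theorem c4_3 : certTo 156000 6294400 [90613600, 23765200, 22047200, 167200] 136593200 187196 56 100 300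
    ⟨189752699036, 180229285806, 7176189327, 3081158997, -656475371, 6852762561⟩
    ⟨334505795428, 320321605660, 11075331977, 4081034551, -864132321, 10647972200⟩ = true := by
  decide +kernel

theorem c4_4 : certTo 156000 6294400 [90613600, 23765200, 22047200, 167200] 136593200 187196 56 100 400
    ⟨334505795428, 320321605660, 11075331977, 4081034551, -864132321, 10647972200⟩
    ⟨519789728150, 500414863621, 15505816009, 5080955499, -1070862674, 14975018882⟩ = true := by
  decide +kernel

theorem c4_5 : certTo 156000 6294400 [90613600, 23765200, 22047200, 167200] 136593200 187196 56 100 500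
    ⟨519789728150, 500414863621, 15505816009, 5080955499, -1070862674, 14975018882⟩
    ⟨745548081033, 720508781162, 20411070305, 6080900314, -1276938609, 19777181520⟩ = true := by
  decide +kernel

theorem c4_6 : certAll 156000 6294400 [90613600, 23765200, 22047200, 167200] 136593200 187196 56 100 600
    ⟨745548081033, 720508781162, 20411070305, 6080900314, -1276938609, 19777181520⟩ = true := by
  decide +kernel

theorem c1 : certAll 1240360 27690800 [0] 0 2461500 1 2 0
    ⟨1523794, 4571382, 0, 13714146, 0, 0⟩ = true := by
  decide +kernel

theorem c2 : certAll 304960 1490000 [40] 40 1681364 2 8 0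
    ⟨1183774, 3551322, 0, 10653966, 0, 40⟩ = true := by
  decide +kernel

theorem c3 : certAll 417600 1583200 [18133600] 18133600 662920 8 56 0
    ⟨568673, 1706019, 0, 5118057, 0, 18133600⟩ = true := by
  decide +kernel

section PartA3
variable {E F : Type*} [NormedAddCommGroup E] [InnerProductSpace ℝ E]
  [NormedAddCommGroup F] [InnerProductSpace ℝ F]

open scoped RealInnerProductSpace

variable {C : Set E} {P : E → E} {M : E →ₗ[ℝ] F} {s : E} {N : ℕ} {W : ℕ → F}
    {g Gs z x u : ℕ → E} {b : F}

theorem certAll_bound (h : Alg C P M s N W g Gs z x u) (hM : ∀ x, ‖M x‖ ≤ ‖x‖)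
    (hVI : ∀ k ≤ N, 2 * ⟪M (x k) - b, W (k + 1) - W k⟫
      ≤ ⟪W (k + 1), W (k + 1)⟫ - ⟪W k, W k⟫ - ⟪W (k + 1) - W k, W (k + 1) - W k⟫)
    (hW : ∀ k ≤ N + 1, ⟪W k, W k⟫ ≤ 4 / ((N : ℝ) + 1) ^ 2)
    {b0 t : ℤ} {lam : List ℤ} {lx : ℤ} {a n k : ℕ} (hb0 : 0 ≤ b0) (hlam : ∀ l ∈ lam, 0 ≤ l)
    {Pk : St} (hc : certAll b0 t lam lam.sum lx a n k Pk = true) (hk : k ≤ N) (hn : N < k + n)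
    (ha : a ≤ N)
    (hv : Vld M b W z x u k Pk (lx + (lam.take (k + 1)).sum * (4 / ((N : ℝ) + 1) ^ 2)))
    {p : E} (hp1 : p ∈ C) (hp2 : ‖p‖ ≤ 1) :
    2 * (((N : ℝ) + 1) * (N + 2) / 4 * ell M s b (W (N + 1)) (u N))
      - 2 * Lsum M s b W N p ≤ 2 + 2 / ((N : ℝ) + 1) := by
  unfold certAll at hc
  split at hc
  · rename_i Q hQ
    exact fin_bound h hM hVI hW hlam
      ((cert_sound h hM hVI hW hb0 hlam n k Pk Q hQ hk hv).2 ha hn) hp1 hp2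
  · simp at hc

theorem certTo_bound (h : Alg C P M s N W g Gs z x u) (hM : ∀ x, ‖M x‖ ≤ ‖x‖)
    (hVI : ∀ k ≤ N, 2 * ⟪M (x k) - b, W (k + 1) - W k⟫
      ≤ ⟪W (k + 1), W (k + 1)⟫ - ⟪W k, W k⟫ - ⟪W (k + 1) - W k, W (k + 1) - W k⟫)
    (hW : ∀ k ≤ N + 1, ⟪W k, W k⟫ ≤ 4 / ((N : ℝ) + 1) ^ 2)
    {b0 t : ℤ} {lam : List ℤ} {lx : ℤ} {a n k : ℕ} (hb0 : 0 ≤ b0) (hlam : ∀ l ∈ lam, 0 ≤ l)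
    {Pk Q : St} (hc : certTo b0 t lam lam.sum lx a n k Pk Q = true) (hk : k ≤ N)
    (ha : a ≤ N)
    (hv : Vld M b W z x u k Pk (lx + (lam.take (k + 1)).sum * (4 / ((N : ℝ) + 1) ^ 2)))
    {p : E} (hp1 : p ∈ C) (hp2 : ‖p‖ ≤ 1) :
    2 * (((N : ℝ) + 1) * (N + 2) / 4 * ell M s b (W (N + 1)) (u N))
      - 2 * Lsum M s b W N p ≤ 2 + 2 / ((N : ℝ) + 1) ∨
    (k + n ≤ N ∧
      Vld M b W z x u (k + n) Q (lx + (lam.take (k + n + 1)).sum * (4 / ((N : ℝ) + 1) ^ 2))) := by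
  unfold certTo at hc
  split at hc
  · rename_i Q' hQ
    have := St.eq_of_eqb hc
    subst this
    have hs := cert_sound h hM hVI hW hb0 hlam n k Pk Q' hQ hk hv
    rcases Nat.lt_or_ge N (k + n) with hN | hN
    · exact Or.inl (fin_bound h hM hVI hW hlam (hs.2 ha hN) hp1 hp2)
    · exact Or.inr ⟨hN, hs.1 hN⟩
  · simp at hc

theorem partA (h : Alg C P M s N W g Gs z x u) (hM : ∀ x, ‖M x‖ ≤ ‖x‖)
    (hVI : ∀ k ≤ N, 2 * ⟪M (x k) - b, W (k + 1) - W k⟫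
      ≤ ⟪W (k + 1), W (k + 1)⟫ - ⟪W k, W k⟫ - ⟪W (k + 1) - W k, W (k + 1) - W k⟫)
    (hW : ∀ k ≤ N + 1, ⟪W k, W k⟫ ≤ 4 / ((N : ℝ) + 1) ^ 2) (hx0 : ‖x 0‖ ≤ 1)
    (hN1 : 1 ≤ N) (hN2 : N < 700) {p : E} (hp1 : p ∈ C) (hp2 : ‖p‖ ≤ 1) :
    2 * (((N : ℝ) + 1) * (N + 2) / 4 * ell M s b (W (N + 1)) (u N))
      - 2 * Lsum M s b W N p ≤ 2 + 2 / ((N : ℝ) + 1) := by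
  rcases Nat.lt_or_ge N 2 with h1 | h1
  ·
    have hv : Vld M b W z x u 0 ⟨1523794, 4571382, 0, 13714146, 0, 0⟩
        ((2461500 : ℤ) + ((List.take (0 + 1) ([0] : List ℤ)).sum : ℤ) * (4 / ((N : ℝ) + 1) ^ 2)) := by
      have := vld_zero (M := M) (b := b) (z := z) (x := x) (u := u) 1523794 2461500 0 (by norm_num)
        (by norm_num) (by norm_num) (by norm_num) hx0 (hW 0 (by omega))
      simpa using this
    exact certAll_bound h hM hVI hW (lam := [0]) (by norm_num) (by simp) c1 (by omega) (by omega) (by omega) hv hp1 hp2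
  rcases Nat.lt_or_ge N 8 with h2 | h2
  ·
    have hv : Vld M b W z x u 0 ⟨1183774, 3551322, 0, 10653966, 0, 40⟩
        ((1681364 : ℤ) + ((List.take (0 + 1) ([40] : List ℤ)).sum : ℤ) * (4 / ((N : ℝ) + 1) ^ 2)) := by
      have := vld_zero (M := M) (b := b) (z := z) (x := x) (u := u) 1183774 1681364 40 (by norm_num)
        (by norm_num) (by norm_num) (by norm_num) hx0 (hW 0 (by omega))
      simpa using this
    exact certAll_bound h hM hVI hW (lam := [40]) (by norm_num) (by simp) c2 (by omega) (by omega) (by omega) hv hp1 hp2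
  rcases Nat.lt_or_ge N 56 with h3 | h3
  ·
    have hv : Vld M b W z x u 0 ⟨568673, 1706019, 0, 5118057, 0, 18133600⟩
        ((662920 : ℤ) + ((List.take (0 + 1) ([18133600] : List ℤ)).sum : ℤ) * (4 / ((N : ℝ) + 1) ^ 2)) := by
      have := vld_zero (M := M) (b := b) (z := z) (x := x) (u := u) 568673 662920 18133600 (by norm_num)
        (by norm_num) (by norm_num) (by norm_num) hx0 (hW 0 (by omega))
      simpa using this
    exact certAll_bound h hM hVI hW (lam := [18133600]) (by norm_num) (by simp) c3 (by omega) (by omega) (by omega) hv hp1 hp2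
  ·
    have hv : Vld M b W z x u 0 ⟨178827, 536481, 0, 1609443, 0, 90613600⟩
        ((187196 : ℤ) + ((List.take (0 + 1) ([90613600, 23765200, 22047200, 167200] : List ℤ)).sum : ℤ) * (4 / ((N : ℝ) + 1) ^ 2)) := by
      have := vld_zero (M := M) (b := b) (z := z) (x := x) (u := u) 178827 187196 90613600 (by norm_num)
        (by norm_num) (by norm_num) (by norm_num) hx0 (hW 0 (by omega))
      simpa using this
    have hl : ∀ l ∈ ([90613600, 23765200, 22047200, 167200] : List ℤ), 0 ≤ l := by simp
    rcases certTo_bound h hM hVI hW (lam := [90613600, 23765200, 22047200, 167200]) (by norm_num) hl c4_0 (Nat.zero_le N) (by omega) hv hp1 hp2 with g1 | g1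
    · exact g1
    rcases certTo_bound h hM hVI hW (lam := [90613600, 23765200, 22047200, 167200]) (by norm_num) hl c4_1 g1.1 (by omega) g1.2 hp1 hp2 with g2 | g2
    · exact g2
    rcases certTo_bound h hM hVI hW (lam := [90613600, 23765200, 22047200, 167200]) (by norm_num) hl c4_2 g2.1 (by omega) g2.2 hp1 hp2 with g3 | g3
    · exact g3
    rcases certTo_bound h hM hVI hW (lam := [90613600, 23765200, 22047200, 167200]) (by norm_num) hl c4_3 g3.1 (by omega) g3.2 hp1 hp2 with g4 | g4
    · exact g4
    rcases certTo_bound h hM hVI hW (lam := [90613600, 23765200, 22047200, 167200]) (by norm_num) hl c4_4 g4.1 (by omega) g4.2 hp1 hp2 with g5 | g5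
    · exact g5
    rcases certTo_bound h hM hVI hW (lam := [90613600, 23765200, 22047200, 167200]) (by norm_num) hl c4_5 g5.1 (by omega) g5.2 hp1 hp2 with g6 | g6
    · exact g6
    exact certAll_bound h hM hVI hW (lam := [90613600, 23765200, 22047200, 167200]) (by norm_num) hl c4_6 g6.1 (by omega) (by omega) g6.2 hp1 hp2
end PartA3
end Nst
namespace Nst
section Scalar

theorem phase1 {N : ℕ} {Z w : ℕ → ℝ} {S μ c : ℝ} (hS0 : 1 / 2 ≤ S) (hμ : 0 ≤ μ)
    (hw0 : ∀ k ≤ N + 1, 0 ≤ w k) (hw : ∀ k ≤ N + 1, w k ≤ μ)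
    (hZ1 : Z 1 ≤ c)
    (hst : ∀ k ≤ N, Z (k + 1) ≤ Z k + (S - ((k : ℝ) + 1) / 2) * w k ^ 2
      - 1 / 6 * (((k : ℝ) + 1) * (k + 2) / 4) * (w (k + 1) - w k) ^ 2) :
    ∀ m ≤ N, Z (m + 1) ≤ c + μ ^ 2 * (S ^ 2 - (max 0 (S - ((m : ℝ) + 1) / 2)) ^ 2)
  | 0, _ => by
      simp only [Nat.cast_zero, zero_add]
      rw [max_eq_right (by linarith)]
      nlinarith [mul_nonneg (sq_nonneg μ) (show 0 ≤ S - 1 / 4 by linarith)]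
  | m + 1, hm => by
      have ih := phase1 hS0 hμ hw0 hw hZ1 hst m (by omega)
      have h1 := hst (m + 1) hm
      push_cast at h1 ⊢
      have h2 : w (m + 1) ^ 2 ≤ μ ^ 2 := by
        gcongr
        · exact hw0 _ (by omega)
        · exact hw _ (by omega)
      have h3 : 0 ≤ 1 / 6 * (((m : ℝ) + 1 + 1) * (m + 1 + 2) / 4) * (w (m + 1 + 1) - w (m + 1)) ^ 2 := by
        positivity
      rcases le_total 0 (S - ((m : ℝ) + 1 + 1) / 2) with h4 | h4
      · rw [max_eq_right h4]
        rw [max_eq_right (by linarith)] at ih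
        have h5 := mul_le_mul_of_nonneg_left h2 h4
        nlinarith [sq_nonneg μ]
      · rw [max_eq_left h4]
        have h5 := mul_nonneg (neg_nonneg.2 h4) (sq_nonneg (w (m + 1)))
        have h6 := mul_nonneg (sq_nonneg μ) (sq_nonneg (max 0 (S - ((m : ℝ) + 1) / 2)))
        nlinarith

theorem cubic_pos {X : ℝ} (n : ℝ) (hX : 0 ≤ X) (hn : 0 < n) :
    0.003115 * n * X ^ 2 ≤ ((n + X) / 3 / 2 - 0.082 * n) *
      (((n + X) / 3) ^ 2 / 24 - 0.00211 * n * X) := by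
  have h1 := mul_nonneg (mul_nonneg hX hX) hX
  have h2 : 0 ≤ X * (X - n) ^ 2 := by positivity
  have h3 : 0 ≤ n ^ 2 * X := by positivity
  have h4 : 0 < n ^ 3 := by positivity
  nlinarith

theorem keyineq {S y : ℝ} (hS : 26.47 ≤ S) (hy : S ^ 2 ≤ 3 * y) :
    ((S / 16 + 1.3) * (3 * y - S ^ 2) / 2) ^ 2 ≤
      (y / 2 - 2 * S - 1.5 * (S / 16 + 1.3)) *
        (y ^ 2 / 24 - (S / 16 + 1.3) * (3 * y - S ^ 2) / 2) := by
  have hc := cubic_pos (X := 3 * y - S ^ 2) (S ^ 2) (by linarith) (by positivity)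
  have e1 : (S ^ 2 + (3 * y - S ^ 2)) / 3 = y := by ring
  rw [e1] at hc
  set X := 3 * y - S ^ 2 with hX
  have hX0 : 0 ≤ X := by linarith
  have hSS : S ≤ 0.0378 * S ^ 2 := by nlinarith
  have hS1 : 1 ≤ 0.00142727 * S ^ 2 + 0 := by nlinarith
  have hB : y / 2 - 0.082 * S ^ 2 ≤ y / 2 - 2 * S - 1.5 * (S / 16 + 1.3) := by nlinarith
  have hB0 : 0 ≤ y / 2 - 0.082 * S ^ 2 := by nlinarith
  have hs1 : S / 16 + 1.3 ≤ 0.1116135 * S := by nlinarith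
  have hs2 : S / 16 + 1.3 ≤ 0.00422 * S ^ 2 := by nlinarith
  have h2 : y ^ 2 / 24 - 0.00211 * S ^ 2 * X ≤ y ^ 2 / 24 - (S / 16 + 1.3) * X / 2 := by
    nlinarith [mul_le_mul_of_nonneg_right hs2 hX0]
  have h3 : ((S / 16 + 1.3) * X / 2) ^ 2 ≤ 0.003115 * S ^ 2 * X ^ 2 := by
    have : ((S / 16 + 1.3)) ^ 2 ≤ (0.1116135 * S) ^ 2 := by gcongr
    nlinarith [mul_le_mul_of_nonneg_right this (sq_nonneg X), sq_nonneg (S * X)]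
  have h4 : 0 ≤ y ^ 2 / 24 - 0.00211 * S ^ 2 * X := by
    have : y = (S ^ 2 + X) / 3 := by rw [hX]; ring
    rw [this]
    nlinarith [mul_nonneg (sq_nonneg S) hX0, sq_nonneg (S ^ 2)]
  calc _ ≤ _ := h3
    _ ≤ _ := hc
    _ ≤ _ := mul_le_mul hB h2 h4 (by linarith)

theorem quad_step {w w' q q' B r : ℝ} (hr : 0 ≤ r) (hB : 0 < B) (hq : 0 < q) (hqq : q ≤ q')
    (h : r ^ 2 ≤ B * (q - r)) :
    r * w' ^ 2 ≤ (r + B) * w ^ 2 + q' * (w' - w) ^ 2 := by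
  have h1 : q * (w' - w) ^ 2 ≤ q' * (w' - w) ^ 2 := by gcongr
  suffices r * w' ^ 2 ≤ (r + B) * w ^ 2 + q * (w' - w) ^ 2 by linarith
  have hp : 0 < r + B + q := by positivity
  have h2 : 0 ≤ (r + B + q) * ((r + B) * w ^ 2 + q * (w' - w) ^ 2 - r * w' ^ 2) := by
    have : (r + B + q) * ((r + B) * w ^ 2 + q * (w' - w) ^ 2 - r * w' ^ 2)
      = ((r + B + q) * w - q * w') ^ 2 + (B * (q - r) - r ^ 2) * w' ^ 2 := by ring
    rw [this]
    have := mul_nonneg (sub_nonneg.2 h) (sq_nonneg w')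
    positivity
  have := nonneg_of_mul_nonneg_right h2 hp
  linarith

theorem phase2 {N K : ℕ} {Z w : ℕ → ℝ} {S c : ℝ} (hS : 26.47 ≤ S) (hSN : S ^ 2 = (N : ℝ) + 1)
    (hK1 : (3 * K : ℝ) ≤ S ^ 2) (hK2 : S ^ 2 ≤ 3 * ((K : ℝ) + 1)) (hZK : Z K ≤ c)
    (hst : ∀ k ≤ N, Z (k + 1) ≤ Z k + (S - ((k : ℝ) + 1) / 2) * w k ^ 2
      - 1 / 6 * (((k : ℝ) + 1) * (k + 2) / 4) * (w (k + 1) - w k) ^ 2) :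
    ∀ j, K + j ≤ N → Z (K + j + 1) + S * w (K + j) ^ 2 ≤
      c - (S / 16 + 1.3) * (3 * ((K + j : ℕ) + 1 : ℝ) - S ^ 2) / 2 * w (K + j + 1) ^ 2 := by
  have key : ∀ k, K ≤ k → k ≤ N →
      Z k ≤ c - (S / 16 + 1.3) * (3 * (k : ℝ) - S ^ 2) / 2 * w k ^ 2 →
      Z (k + 1) + S * w k ^ 2 ≤
      c - (S / 16 + 1.3) * (3 * ((k : ℝ) + 1 : ℝ) - S ^ 2) / 2 * w (k + 1) ^ 2 := by
    intro k hk1 hk2 hk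
    have h1 := hst k hk2
    have hkK : (K : ℝ) ≤ k := by exact_mod_cast hk1
    have hy : S ^ 2 ≤ 3 * ((k : ℝ) + 1) := by linarith
    have h2 := keyineq hS hy
    have hk0 : (0 : ℝ) ≤ k := by positivity
    have h3 := quad_step (w := w k) (w' := w (k + 1)) (q := ((k : ℝ) + 1) ^ 2 / 24)
      (q' := 1 / 6 * (((k : ℝ) + 1) * (k + 2) / 4))
      (B := ((k : ℝ) + 1) / 2 - 2 * S - 1.5 * (S / 16 + 1.3))
      (r := (S / 16 + 1.3) * (3 * ((k : ℝ) + 1) - S ^ 2) / 2)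
      (by have : 0 ≤ 3 * ((k : ℝ) + 1) - S ^ 2 := by linarith
          positivity)
      (by nlinarith) (by positivity) (by nlinarith) h2
    nlinarith
  intro j
  induction j with
  | zero =>
      intro hj
      refine key K le_rfl (by simpa using hj) ?_
      have : 0 ≤ (S / 16 + 1.3) * (S ^ 2 - 3 * (K : ℝ)) / 2 * w K ^ 2 := by
        have : 0 ≤ S ^ 2 - 3 * (K : ℝ) := by linarith
        positivity
      linarith
  | succ j ih =>
      intro hj
      have h1 := ih (by omega)
      refine key (K + (j + 1)) (by omega) hj ?_
      have : 0 ≤ S * w (K + j) ^ 2 := by positivity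
      have e : K + (j + 1) = K + j + 1 := by ring
      rw [e]
      push_cast at h1 ⊢
      linarith

theorem scalar_main {N : ℕ} {Z w : ℕ → ℝ} {S : ℝ} (hN : 700 ≤ N) (hS0 : 0 ≤ S)
    (hSN : S ^ 2 = (N : ℝ) + 1)
    (hw0 : ∀ k ≤ N + 1, 0 ≤ w k) (hw : ∀ k ≤ N + 1, w k ≤ 2 / S ^ 2)
    (hZ1 : Z 1 ≤ 2 / S ^ 2 + 1 / (4 * S))
    (hst : ∀ k ≤ N, Z (k + 1) ≤ Z k + (S - ((k : ℝ) + 1) / 2) * w k ^ 2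
      - 1 / 6 * (((k : ℝ) + 1) * (k + 2) / 4) * (w (k + 1) - w k) ^ 2) :
    1 + 2.75 / (((N : ℝ) + 1) * (N + 2) / 4) + Z (N + 1) + S * w N ^ 2
      + (S + ((N : ℝ) + 1) * (N + 2) / 4) * w (N + 1) ^ 2 ≤ 2 + 2 / ((N : ℝ) + 1) := by
  have hNr : (700 : ℝ) ≤ N := by exact_mod_cast hN
  have hS : 26.47 ≤ S := by nlinarith
  have hp1 := phase1 (by linarith) (by positivity) hw0 hw hZ1 hst
  set K := (N + 1) / 3 with hK
  have hKa : 3 * K ≤ N + 1 := by omega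
  have hKb : N + 1 ≤ 3 * (K + 1) := by omega
  have hKN : K ≤ N := by omega
  have hK0 : K - 1 + 1 = K := by omega
  have hZK : Z K ≤ 6 / S ^ 2 + 1 / (4 * S) := by
    have h1 := hp1 (K - 1) (by omega)
    rw [hK0] at h1
    have h2 : (2 / S ^ 2) ^ 2 * (S ^ 2 - (max 0 (S - (((K - 1 : ℕ) : ℝ) + 1) / 2)) ^ 2)
        ≤ (2 / S ^ 2) ^ 2 * S ^ 2 := by
      gcongr
      have := sq_nonneg (max 0 (S - (((K - 1 : ℕ) : ℝ) + 1) / 2))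
      linarith
    have h3 : (2 / S ^ 2) ^ 2 * S ^ 2 = 4 / S ^ 2 := by
      field_simp; norm_num
    have h4 : 6 / S ^ 2 = 2 / S ^ 2 + 4 / S ^ 2 := by ring
    linarith
  have hp2 := phase2 (K := K) hS hSN (by rw [hSN]; exact_mod_cast hKa)
    (by rw [hSN]; exact_mod_cast hKb) hZK hst (N - K) (by omega)
  have e : K + (N - K) = N := by omega
  rw [e] at hp2
  have h5 : w (N + 1) ^ 2 ≤ (2 / S ^ 2) ^ 2 := by
    gcongr
    · exact hw0 _ le_rfl
    · exact hw _ le_rfl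
  have hN1 : (N : ℝ) = S ^ 2 - 1 := by linarith
  rw [hN1] at hp2 ⊢
  have h6 : 0 ≤ S + (S ^ 2 - 1 + 1) * (S ^ 2 - 1 + 2) / 4
      - (S / 16 + 1.3) * (3 * (S ^ 2 - 1 + 1) - S ^ 2) / 2 := by
    have h61 : 0 ≤ S ^ 2 / 4 + 1 / 4 - S / 16 - 1.3 := by nlinarith
    have h62 := mul_nonneg (sq_nonneg S) h61
    nlinarith
  have h7 := mul_le_mul_of_nonneg_left h5 h6
  have h8 : (S + (S ^ 2 - 1 + 1) * (S ^ 2 - 1 + 2) / 4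
      - (S / 16 + 1.3) * (3 * (S ^ 2 - 1 + 1) - S ^ 2) / 2) * (2 / S ^ 2) ^ 2
      + (6 / S ^ 2 + 1 / (4 * S)) + 2.75 / ((S ^ 2 - 1 + 1) * (S ^ 2 - 1 + 2) / 4) + 1
      ≤ 2 + 2 / (S ^ 2 - 1 + 1) := by
    have hSp : 0 < S := by linarith
    have e1 : (S + (S ^ 2 - 1 + 1) * (S ^ 2 - 1 + 2) / 4
      - (S / 16 + 1.3) * (3 * (S ^ 2 - 1 + 1) - S ^ 2) / 2) * (2 / S ^ 2) ^ 2
      + (6 / S ^ 2 + 1 / (4 * S)) = 1 + (4 / S + 1.8) / S ^ 2 := by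
      field_simp
      ring
    have e2 : 2.75 / ((S ^ 2 - 1 + 1) * (S ^ 2 - 1 + 2) / 4) = (11 / (S ^ 2 + 1)) / S ^ 2 := by
      have : S ^ 2 - 1 + 2 = S ^ 2 + 1 := by ring
      rw [this]
      field_simp
      ring
    have e3 : 2 / (S ^ 2 - 1 + 1) = 2 / S ^ 2 := by congr 1; ring
    rw [e1, e2, e3]
    have h9 : 4 / S ≤ 0.16 := by rw [div_le_iff₀ hSp]; linarith
    have h10 : 11 / (S ^ 2 + 1) ≤ 0.016 := by rw [div_le_iff₀ (by positivity)]; nlinarith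
    have h11 : (4 / S + 1.8) / S ^ 2 + (11 / (S ^ 2 + 1)) / S ^ 2 ≤ 2 / S ^ 2 := by
      rw [← add_div]; gcongr; linarith
    linarith
  linarith

end Scalar
end Nst
namespace Nst
section Tilde
variable {E F : Type*} [NormedAddCommGroup E] [InnerProductSpace ℝ E]
  [NormedAddCommGroup F] [InnerProductSpace ℝ F]

open scoped RealInnerProductSpace

theorem sq_cross {p : ℝ} (hp : 0 < p) (x y : E) :
    0 ≤ p * ⟪x, x⟫ + 2 * ⟪x, y⟫ + 1 / p * ⟪y, y⟫ := by
  have h := real_inner_self_nonneg (x := p • x + y)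
  simp only [inner_add_left, inner_add_right, real_inner_smul_left, real_inner_smul_right,
    real_inner_comm x y] at h
  have h2 : p * ⟪x, x⟫ + 2 * ⟪x, y⟫ + 1 / p * ⟪y, y⟫
    = 1 / p * (p * (p * ⟪x, x⟫) + p * ⟪x, y⟫ + (p * ⟪x, y⟫ + ⟪y, y⟫)) := by
    field_simp; ring
  rw [h2]
  positivity

theorem quad4 {p1 p2 b1 c1 b2 c2 m n o : ℝ} (hp1 : 0 < p1) (hp2 : 0 < p2)
    {S T U : ℝ} (hS : S = m - b1 ^ 2 / p1 - b2 ^ 2 / p2) (hT : T = n - b1 * c1 / p1 - b2 * c2 / p2)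
    (hU : U = o - c1 ^ 2 / p1 - c2 ^ 2 / p2) (hS0 : 0 < S) (hd : T ^ 2 / S ≤ U)
    (x1 x2 x3 x4 : E) :
    0 ≤ p1 * ⟪x1, x1⟫ + 2 * b1 * ⟪x1, x3⟫ + 2 * c1 * ⟪x1, x4⟫
      + p2 * ⟪x2, x2⟫ + 2 * b2 * ⟪x2, x3⟫ + 2 * c2 * ⟪x2, x4⟫
      + m * ⟪x3, x3⟫ + 2 * n * ⟪x3, x4⟫ + o * ⟪x4, x4⟫ := by
  have h1 := sq_cross hp1 x1 (b1 • x3 + c1 • x4)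
  have h2 := sq_cross hp2 x2 (b2 • x3 + c2 • x4)
  have h3 := sq_cross hS0 x3 (T • x4)
  have h4 := mul_le_mul_of_nonneg_right hd (real_inner_self_nonneg (x := x4))
  simp only [inner_add_left, inner_add_right, real_inner_smul_left, real_inner_smul_right,
    real_inner_comm x3 x4] at h1 h2 h3
  have h5 : 0 ≤ S * ⟪x3, x3⟫ + 2 * (T * ⟪x3, x4⟫) + U * ⟪x4, x4⟫ := by
    have : 1 / S * (T * (T * ⟪x4, x4⟫)) = T ^ 2 / S * ⟪x4, x4⟫ := by ring
    linarith
  have h6 : p1 * ⟪x1, x1⟫ + 2 * b1 * ⟪x1, x3⟫ + 2 * c1 * ⟪x1, x4⟫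
      + p2 * ⟪x2, x2⟫ + 2 * b2 * ⟪x2, x3⟫ + 2 * c2 * ⟪x2, x4⟫
      + m * ⟪x3, x3⟫ + 2 * n * ⟪x3, x4⟫ + o * ⟪x4, x4⟫
    = (p1 * ⟪x1, x1⟫ + 2 * (b1 * ⟪x1, x3⟫ + c1 * ⟪x1, x4⟫)
      + 1 / p1 * (b1 * (b1 * ⟪x3, x3⟫) + b1 * (c1 * ⟪x3, x4⟫)
        + (c1 * (b1 * ⟪x3, x4⟫) + c1 * (c1 * ⟪x4, x4⟫))))
      + (p2 * ⟪x2, x2⟫ + 2 * (b2 * ⟪x2, x3⟫ + c2 * ⟪x2, x4⟫)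
      + 1 / p2 * (b2 * (b2 * ⟪x3, x3⟫) + b2 * (c2 * ⟪x3, x4⟫)
        + (c2 * (b2 * ⟪x3, x4⟫) + c2 * (c2 * ⟪x4, x4⟫))))
      + (S * ⟪x3, x3⟫ + 2 * (T * ⟪x3, x4⟫) + U * ⟪x4, x4⟫) := by
    rw [hS, hT, hU]; ring
  rw [h6]
  refine add_nonneg (add_nonneg ?_ ?_) h5
  · convert h1 using 3
  · convert h2 using 3

/-- the potential -/
noncomputable def Psi (t : ℝ) (h r : E) : ℝ :=
  1 / (t + 4) * ⟪h, h⟫ + (t + 1) * ⟪r, h⟫ + 1.3 * ((t + 1) * (t + 2) / 4) * ⟪r, r⟫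

theorem psi_step {t : ℝ} (ht : 0 ≤ t) (h r h' r' d : E) (hd : d = r' + (2 / (t + 3)) • h) :
    Psi (t + 1) h' r' + (t + 1) * (t + 2) / 2 * ⟪r', (2 / (t + 2)) • h - d⟫
      - (t + 1) * (t + 2) / 2 * ⟪r' - r, d⟫
      + 6 / 5 * ((t + 1) * (t + 2) / 4) *
        ⟪r + (2 / (t + 2)) • h - d, r + (2 / (t + 2)) • h - d⟫
      - ⟪h' - h + d, h' - h + d⟫ ≤ Psi t h r := by
  have h1 := quad4 (p1 := (4 + t) / (5 + t)) (p2 := (t + 1) * (t + 2) / 40)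
    (b1 := -(t + 1) / (t + 3)) (c1 := -t / 2) (b2 := -(t + 1) / 10 / (t + 3))
    (c2 := (t + 1) * (t + 2) / 20)
    (m := (106/5 + 37*t + 139/5*t^2 + 9*t^3 + t^4) / ((t + 2) * (t + 3) ^ 2 * (t + 4)))
    (n := (1/10 + 3/5*t + 1/2*t^2) / (t + 3)) (o := 9/20 + 19/40*t + 3/8*t^2)
    (S := (48/5 + 8*t + 12/5*t^2) / ((t + 2) * (t + 3) ^ 2 * (t + 4)))
    (T := (6/5 + t - 1/5*t^2) / ((t + 3) * (t + 4)))
    (U := (1 + 19/20*t + 1/40*t^2 + 1/40*t^3) / (t + 4))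
    (by positivity) (by positivity)
    (by field_simp; ring) (by field_simp; ring) (by field_simp; ring) (by positivity)
    (by
      have h0 : 0 < 48/5 + 8*t + 12/5*t^2 := by positivity
      have h00 : (6/5 + t - 1/5*t^2) ^ 2 * (t + 2) ≤
        (1 + 19/20*t + 1/40*t^2 + 1/40*t^3) * (48/5 + 8*t + 12/5*t^2) := by
        have : 0 ≤ t ^ 2 := by positivity
        have : 0 ≤ t ^ 3 := by positivity
        have : 0 ≤ t ^ 4 := by positivity
        have : 0 ≤ t ^ 5 := by positivity
        nlinarith
      have e : ((6/5 + t - 1/5*t^2) / ((t + 3) * (t + 4))) ^ 2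
        / ((48/5 + 8*t + 12/5*t^2) / ((t + 2) * (t + 3) ^ 2 * (t + 4)))
        = ((6/5 + t - 1/5*t^2) ^ 2 * (t + 2) / (48/5 + 8*t + 12/5*t^2)) / (t + 4) := by
        field_simp
      rw [e]
      gcongr
      rw [div_le_iff₀ h0]
      exact h00) h' r h r'
  subst hd
  rw [← sub_nonneg]
  convert h1 using 1
  simp only [Psi, inner_add_left, inner_add_right, inner_sub_left, inner_sub_right,
    real_inner_smul_left, real_inner_smul_right, real_inner_comm h h', real_inner_comm h r,
    real_inner_comm h r', real_inner_comm r r', real_inner_comm r' h', real_inner_comm r h']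
  field_simp
  ring

end Tilde
end Nst
namespace Nst
section PartB
variable {E F : Type*} [NormedAddCommGroup E] [InnerProductSpace ℝ E]
  [NormedAddCommGroup F] [InnerProductSpace ℝ F]

open scoped RealInnerProductSpace

/-- auxiliary trajectory started at the prox center -/
noncomputable def xt (P : E → E) (g z : ℕ → E) : ℕ → E
  | 0 => 0
  | k + 1 => (2 / ((k : ℝ) + 3)) • z k + (1 - 2 / ((k : ℝ) + 3)) • P (xt P g z k - g k)

/-- projected points of the auxiliary trajectory -/
noncomputable def ut (P : E → E) (g z : ℕ → E) (k : ℕ) : E := P (xt P g z k - g k)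

/-- scaled deviation of the two trajectories -/
noncomputable def ee (P : E → E) (g z x u : ℕ → E) : ℕ → E
  | 0 => x 0
  | k + 1 => (((k : ℝ) + 1) * ((k : ℝ) + 2) / 2) • (u k - ut P g z k)

variable {C : Set E} {P : E → E} {M : E →ₗ[ℝ] F} {s : E} {N : ℕ} {W : ℕ → F}
    {g Gs z x u : ℕ → E} {b : F}

theorem Alg.tilde (h : Alg C P M s N W g Gs z x u) :
    Alg C P M s N W g Gs z (xt P g z) (ut P g z) where
  conv := h.conv
  pmem := h.pmem
  pvi := h.pvi
  hg := h.hg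
  hG0 := h.hG0
  hG := h.hG
  hu := fun _ _ => rfl
  hz := h.hz
  hx := fun _ _ => rfl

theorem Alg.ee_eq (h : Alg C P M s N W g Gs z x u) : ∀ k ≤ N,
    ee P g z x u k = (((k : ℝ) + 1) * ((k : ℝ) + 2) / 2) • (x k - xt P g z k)
  | 0, _ => by simp [ee, xt]
  | k + 1, hk => by
      rw [h.hx k hk]
      simp only [ee, xt, ut]
      have e : (((k + 1 : ℕ) : ℝ) + 1) * (((k + 1 : ℕ) : ℝ) + 2) / 2 * (1 - 2 / ((k : ℝ) + 3))
        = ((k : ℝ) + 1) * ((k : ℝ) + 2) / 2 := by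
        push_cast
        field_simp
        ring
      rw [← e]
      module

theorem Alg.firm (h : Alg C P M s N W g Gs z x u) {k : ℕ} (hk : k ≤ N) :
    ‖ee P g z x u k - ee P g z x u (k + 1)‖ ^ 2 + ‖ee P g z x u (k + 1)‖ ^ 2
      ≤ ‖ee P g z x u k‖ ^ 2 := by
  have h1 := h.pvi (x k - g k) (ut P g z k) (h.tilde.umem hk)
  have h2 := h.pvi (xt P g z k - g k) (u k) (h.umem hk)
  rw [← h.hu k hk] at h1
  rw [show P (xt P g z k - g k) = ut P g z k from rfl] at h2
  have h3 : 0 ≤ ⟪(x k - xt P g z k) - (u k - ut P g z k), u k - ut P g z k⟫ := by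
    have e : ⟪(x k - xt P g z k) - (u k - ut P g z k), u k - ut P g z k⟫
      = - ⟪x k - g k - u k, ut P g z k - u k⟫
        - ⟪xt P g z k - g k - ut P g z k, u k - ut P g z k⟫ := by
      simp only [inner_sub_left, inner_sub_right]; ring
    linarith
  set c := ((k : ℝ) + 1) * ((k : ℝ) + 2) / 2 with hc
  have e1 := h.ee_eq k hk
  have e2 : ee P g z x u (k + 1) = c • (u k - ut P g z k) := rfl
  have h4 : 0 ≤ ⟪ee P g z x u k - ee P g z x u (k + 1), ee P g z x u (k + 1)⟫ := by
    rw [e1, e2, ← smul_sub, real_inner_smul_left, real_inner_smul_right]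
    positivity
  have h5 := norm_add_sq_real (ee P g z x u k - ee P g z x u (k + 1)) (ee P g z x u (k + 1))
  rw [sub_add_cancel] at h5
  linarith

/-- accumulated dual terms -/
noncomputable def Om (M : E →ₗ[ℝ] F) (W : ℕ → F) (e : ℕ → E) : ℕ → ℝ
  | 0 => 0
  | k + 1 => Om M W e k
      + ((k : ℝ) + 1) * ((k : ℝ) + 2) / 4 * (⟪W (k + 1), W (k + 1)⟫ - ⟪W k, W k⟫)
      - 1 / 6 * (((k : ℝ) + 1) * ((k : ℝ) + 2) / 4) * ⟪W (k + 1) - W k, W (k + 1) - W k⟫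
      - ⟪M (e k), W (k + 1) - W k⟫

theorem young (hM : ∀ x, ‖M x‖ ≤ ‖x‖) (a : E) (D : F) :
    2 * ⟪M a, D⟫ ≤ 6 / 5 * ⟪a, a⟫ + 5 / 6 * ⟪D, D⟫ := by
  have h1 := le_of_abs_le (inner_M_le M hM a D)
  rw [real_inner_self_eq_norm_sq, real_inner_self_eq_norm_sq]
  nlinarith [sq_nonneg (6 * ‖a‖ - 5 * ‖D‖)]

theorem Alg.claimT (h : Alg C P M s N W g Gs z x u) (hM : ∀ x, ‖M x‖ ≤ ‖x‖)
    (hVI : ∀ k ≤ N, 2 * ⟪M (x k) - b, W (k + 1) - W k⟫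
      ≤ ⟪W (k + 1), W (k + 1)⟫ - ⟪W k, W k⟫ - ⟪W (k + 1) - W k, W (k + 1) - W k⟫) :
    ∀ k ≤ N, ∀ q, Rem M b W z (xt P g z) (ut P g z) k q
      ≤ -Psi (k : ℝ) (q - ut P g z k) (ut P g z k - xt P g z k) + Om M W (ee P g z x u) k
  | 0, _, q => by
      simp only [Rem, Om, xt, Psi, Nat.cast_zero, sub_zero]
      have e : q = (q - ut P g z 0) + ut P g z 0 := by abel
      set r := ut P g z 0
      set h0 := q - r
      rw [e, norm_add_sq_real, real_inner_self_eq_norm_sq, real_inner_self_eq_norm_sq]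
      have h2 := real_inner_self_nonneg (x := (3 : ℝ) • h0 + (2 : ℝ) • r)
      simp only [inner_add_left, inner_add_right, real_inner_smul_left, real_inner_smul_right,
        real_inner_comm r h0] at h2
      rw [real_inner_self_eq_norm_sq, real_inner_self_eq_norm_sq] at h2
      have h3 := sq_nonneg ‖r‖
      rw [real_inner_comm r h0]
      nlinarith
  | k + 1, hk, q => by
      have ih := Alg.claimT h hM hVI k (by omega) (z k)
      have hmono := h.tilde.mono hk
      have hv := hVI k (by omega)
      have hee := h.ee_eq k (by omega)
      have hx' : xt P g z (k + 1) = ut P g z k + (2 / ((k : ℝ) + 3)) • (z k - ut P g z k) := by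
        rw [h.tilde.hx k hk]; module
      simp only [Rem, Om, yy]
      set e := ee P g z x u
      generalize xt P g z k = X at *
      generalize ut P g z k = U at *
      generalize xt P g z (k + 1) = X' at *
      generalize ut P g z (k + 1) = U' at *
      have ht : (0 : ℝ) ≤ k := by positivity
      have hst := psi_step ht (z k - U) (U - X) (q - U') (U' - X') (U' - U) (by rw [hx']; module)
      have e1 : U + (2 / ((k : ℝ) + 2)) • (z k - U) - U' = (2 / ((k : ℝ) + 2)) • (z k - U) - (U' - U) := by
        abel
      have e2 : q - U' - (z k - U) + (U' - U) = q - z k := by abel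
      have hy := young hM ((U - X) + (2 / ((k : ℝ) + 2)) • (z k - U) - (U' - U)) (W (k + 1) - W k)
      have e3 : ((k : ℝ) + 1) * ((k : ℝ) + 2) / 2 *
          ⟪M (U + (2 / ((k : ℝ) + 2)) • (z k - U)) - b, W (k + 1) - W k⟫
        = ((k : ℝ) + 1) * ((k : ℝ) + 2) / 2 * ⟪M (x k) - b, W (k + 1) - W k⟫
          - ⟪M (e k), W (k + 1) - W k⟫
          + ((k : ℝ) + 1) * ((k : ℝ) + 2) / 2 *
            (⟪M ((U - X) + (2 / ((k : ℝ) + 2)) • (z k - U) - (U' - U)), W (k + 1) - W k⟫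
              + ⟪M (U' - U), W (k + 1) - W k⟫) := by
        rw [hee]
        simp only [map_add, map_sub, map_smul, inner_add_left, inner_sub_left,
          real_inner_smul_left]
        ring
      rw [e1, mul_add, e3]
      rw [e2, real_inner_self_eq_norm_sq (q - z k)] at hst
      have hA : (0 : ℝ) ≤ ((k : ℝ) + 1) * ((k : ℝ) + 2) / 4 := by positivity
      have m1 := mul_le_mul_of_nonneg_left hmono hA
      have m2 := mul_le_mul_of_nonneg_left hv hA
      have m3 := mul_le_mul_of_nonneg_left hy hA
      push_cast
      linarith

/-- dual terms after summation by parts -/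
theorem Om_step (hM : ∀ x, ‖M x‖ ≤ ‖x‖) (e : ℕ → E) (k : ℕ) :
    Om M W e (k + 1) + ⟪M (e (k + 1)), W (k + 1)⟫ ≤ Om M W e k + ⟪M (e k), W k⟫
      + ((k : ℝ) + 1) * ((k : ℝ) + 2) / 4 * (‖W (k + 1)‖ ^ 2 - ‖W k‖ ^ 2)
      - 1 / 6 * (((k : ℝ) + 1) * ((k : ℝ) + 2) / 4) * (‖W (k + 1)‖ - ‖W k‖) ^ 2
      + ‖e k - e (k + 1)‖ * ‖W (k + 1)‖ := by
  have h1 := neg_le_of_abs_le (inner_M_le M hM (e k - e (k + 1)) (W (k + 1)))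
  have h2 : (‖W (k + 1)‖ - ‖W k‖) ^ 2 ≤ ⟪W (k + 1) - W k, W (k + 1) - W k⟫ := by
    rw [real_inner_self_eq_norm_sq]
    exact sq_le_sq' (by linarith [norm_sub_norm_le (W k) (W (k + 1)), norm_sub_rev (W k) (W (k + 1))])
      (norm_sub_norm_le _ _)
  have h3 := mul_le_mul_of_nonneg_left h2
    (show (0 : ℝ) ≤ 1 / 6 * (((k : ℝ) + 1) * ((k : ℝ) + 2) / 4) by positivity)
  simp only [Om]
  simp only [map_sub, inner_sub_left] at h1
  rw [inner_sub_right (M (e k)), real_inner_self_eq_norm_sq (W (k + 1)), real_inner_self_eq_norm_sq (W k)]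
  linarith

theorem Alg.finalT (h : Alg C P M s N W g Gs z x u) (hM : ∀ x, ‖M x‖ ≤ ‖x‖)
    (hVI : ∀ k ≤ N, 2 * ⟪M (x k) - b, W (k + 1) - W k⟫
      ≤ ⟪W (k + 1), W (k + 1)⟫ - ⟪W k, W k⟫ - ⟪W (k + 1) - W k, W (k + 1) - W k⟫)
    (he : ∀ k ≤ N + 1, ‖ee P g z x u k‖ ≤ 1) {p : E} (hp1 : p ∈ C) (hp2 : ‖p‖ ≤ 1) :
    2 * (((N : ℝ) + 1) * (N + 2) / 4 * ell M s b (W (N + 1)) (u N))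
      - 2 * Lsum M s b W N p ≤ 1 + 2.75 / (((N : ℝ) + 1) * (N + 2) / 4)
        + Om M W (ee P g z x u) (N + 1) + ⟪M (ee P g z x u (N + 1)), W (N + 1) - W N⟫ := by
  have h1 := h.tilde.final (b := b) hp1
  have h2 := h.claimT hM hVI N le_rfl p
  have h3 := h.ell_le (b := b) le_rfl (h.tilde.umem le_rfl)
  have hv := hVI N le_rfl
  have hee := h.ee_eq N le_rfl
  have hee' : ee P g z x u (N + 1) = (((N : ℝ) + 1) * ((N : ℝ) + 2) / 2) • (u N - ut P g z N) := rfl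
  have he1 := he N (by omega)
  have he2 := he (N + 1) le_rfl
  have hf := h.firm le_rfl
  simp only [Om]
  set e := ee P g z x u
  generalize xt P g z N = X at *
  generalize ut P g z N = U at *
  have h4 : ell M s b (W (N + 1)) (u N) = ell M s b (W N) (u N)
          + ⟪M (x N) - b, W (N + 1) - W N⟫ + ⟪M (u N - x N), W (N + 1) - W N⟫ := by
    simp only [ell, inner_sub_right, map_sub, inner_sub_left]; ring
  have hA : (0 : ℝ) < ((N : ℝ) + 1) * ((N : ℝ) + 2) / 4 := by positivity
  have hy := young hM (U - X) (W (N + 1) - W N)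
  have e1 : ((N : ℝ) + 1) * ((N : ℝ) + 2) / 2 * ⟪M (u N - x N), W (N + 1) - W N⟫
    = ((N : ℝ) + 1) * ((N : ℝ) + 2) / 2 * ⟪M (U - X), W (N + 1) - W N⟫
      + ⟪M (e (N + 1)), W (N + 1) - W N⟫ - ⟪M (e N), W (N + 1) - W N⟫ := by
    rw [hee, hee']
    simp only [map_add, map_sub, map_smul, inner_sub_left, real_inner_smul_left]
    ring
  have e2 : ((N : ℝ) + 1) * ((N : ℝ) + 2) / 2 * ⟪u N - x N, U - u N⟫
    = - ⟪U - X, e (N + 1)⟫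
      + 1 / (((N : ℝ) + 1) * ((N : ℝ) + 2) / 2) * ⟪e N - e (N + 1), e (N + 1)⟫ := by
    rw [hee, hee', ← smul_sub]
    simp only [real_inner_smul_left, real_inner_smul_right]
    have : u N - x N = (U - X) - ((x N - X) - (u N - U)) := by abel
    rw [this, ← neg_sub (u N) U, inner_neg_right, inner_sub_left]
    field_simp
    ring
  have h5 : ⟪e N - e (N + 1), e (N + 1)⟫ ≤ 1 / 2 := by
    have := real_inner_le_norm (e N - e (N + 1)) (e (N + 1))
    have h6 : ‖e N‖ ^ 2 ≤ 1 := by nlinarith [norm_nonneg (e N)]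
    nlinarith [sq_nonneg (‖e N - e (N + 1)‖ - ‖e (N + 1)‖)]
  have h6 := mul_le_mul_of_nonneg_left h5
    (show 0 ≤ 1 / (((N : ℝ) + 1) * ((N : ℝ) + 2) / 2) by positivity)
  have h7 := sq_cross (show 0 < 0.2 * (((N : ℝ) + 1) * ((N : ℝ) + 2) / 4) by positivity)
    (U - X) (e (N + 1))
  have h8 : ⟪e (N + 1), e (N + 1)⟫ ≤ 1 := by
    rw [real_inner_self_eq_norm_sq]; nlinarith [norm_nonneg (e (N + 1))]
  have h9 := mul_le_mul_of_nonneg_left h8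
    (show 0 ≤ 1 / (0.2 * (((N : ℝ) + 1) * ((N : ℝ) + 2) / 4)) by positivity)
  have h10 : 2.75 / (((N : ℝ) + 1) * ((N : ℝ) + 2) / 4)
    = 1 / 2 * (1 / (0.2 * (((N : ℝ) + 1) * ((N : ℝ) + 2) / 4)) * 1)
      + 1 / (((N : ℝ) + 1) * ((N : ℝ) + 2) / 2) * (1 / 2) := by
    field_simp; norm_num
  have m1 := mul_le_mul_of_nonneg_left h3 hA.le
  have m2 := mul_le_mul_of_nonneg_left hv hA.le
  have m3 := mul_le_mul_of_nonneg_left hy hA.le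
  have h11 : ‖p‖ ^ 2 ≤ 1 := by nlinarith [norm_nonneg p]
  have h12 : 0 ≤ 1 / ((N : ℝ) + 4) * ⟪p - U, p - U⟫ :=
    mul_nonneg (by positivity) real_inner_self_nonneg
  rw [Psi] at h2
  rw [h4, h10]
  linarith

theorem partB (h : Alg C P M s N W g Gs z x u) (hM : ∀ x, ‖M x‖ ≤ ‖x‖)
    (hVI : ∀ k ≤ N, 2 * ⟪M (x k) - b, W (k + 1) - W k⟫
      ≤ ⟪W (k + 1), W (k + 1)⟫ - ⟪W k, W k⟫ - ⟪W (k + 1) - W k, W (k + 1) - W k⟫)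
    (hW : ∀ k ≤ N + 1, ⟪W k, W k⟫ ≤ 4 / ((N : ℝ) + 1) ^ 2) (hx0 : ‖x 0‖ ≤ 1)
    (hN : 700 ≤ N) {p : E} (hp1 : p ∈ C) (hp2 : ‖p‖ ≤ 1) :
    2 * (((N : ℝ) + 1) * (N + 2) / 4 * ell M s b (W (N + 1)) (u N))
      - 2 * Lsum M s b W N p ≤ 2 + 2 / ((N : ℝ) + 1) := by
  have hfirm : ∀ k ≤ N, _ := fun k hk => h.firm (k := k) hk
  have he : ∀ k ≤ N + 1, ‖ee P g z x u k‖ ≤ 1 := by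
    intro k
    induction k with
    | zero => intro _; exact hx0
    | succ k ih =>
      intro hk
      have h1 := ih (by omega)
      have h2 := hfirm k (by omega)
      have : ‖ee P g z x u (k + 1)‖ ≤ ‖ee P g z x u k‖ :=
        le_of_sq_le_sq (by nlinarith [sq_nonneg ‖ee P g z x u k - ee P g z x u (k + 1)‖])
          (norm_nonneg _)
      linarith
  have hfin := h.finalT hM hVI he hp1 hp2
  set e := ee P g z x u with hedef
  have hNr : (700 : ℝ) ≤ N := by exact_mod_cast hN
  set S := √((N : ℝ) + 1) with hS
  have hSN : S ^ 2 = (N : ℝ) + 1 := Real.sq_sqrt (by positivity)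
  have hSp : 0 < S := Real.sqrt_pos.2 (by positivity)
  have hw : ∀ k ≤ N + 1, ‖W k‖ ≤ 2 / S ^ 2 := by
    intro k hk
    have h1 := hW k hk
    rw [real_inner_self_eq_norm_sq, ← hSN] at h1
    refine le_of_sq_le_sq ?_ (by positivity)
    calc _ ≤ _ := h1
      _ = _ := by rw [div_pow]; norm_num
  have hyS : ∀ (a : ℝ) (c : ℝ), a * c ≤ 1 / (4 * S) * a ^ 2 + S * c ^ 2 := by
    intro a c
    have : 0 ≤ 1 / (4 * S) * (a - 2 * S * c) ^ 2 := by positivity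
    have e : 1 / (4 * S) * (a - 2 * S * c) ^ 2 = 1 / (4 * S) * a ^ 2 - a * c + S * c ^ 2 := by
      field_simp; ring
    linarith
  have hstep : ∀ k ≤ N, Om M W e (k + 1) + ⟪M (e (k + 1)), W (k + 1)⟫
      + 1 / (4 * S) * ‖e (k + 1)‖ ^ 2 ≤ Om M W e k + ⟪M (e k), W k⟫
      + 1 / (4 * S) * ‖e k‖ ^ 2
      + ((k : ℝ) + 1) * ((k : ℝ) + 2) / 4 * (‖W (k + 1)‖ ^ 2 - ‖W k‖ ^ 2)
      - 1 / 6 * (((k : ℝ) + 1) * ((k : ℝ) + 2) / 4) * (‖W (k + 1)‖ - ‖W k‖) ^ 2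
      + S * ‖W (k + 1)‖ ^ 2 := by
    intro k hk
    have h1 := Om_step (M := M) (W := W) hM e k
    have h2 := hyS ‖e k - e (k + 1)‖ ‖W (k + 1)‖
    have h3 := mul_le_mul_of_nonneg_left (hfirm k hk) (show 0 ≤ 1 / (4 * S) by positivity)
    linarith
  have hsc := scalar_main (N := N) (S := S) (w := fun k => ‖W k‖)
    (Z := fun k => Om M W e k + ⟪M (e k), W k⟫ + 1 / (4 * S) * ‖e k‖ ^ 2
      - (k : ℝ) * (k + 1) / 4 * ‖W k‖ ^ 2 - S * ‖W k‖ ^ 2) hN hSp.le hSN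
    (fun k _ => norm_nonneg _) hw
    (by
      have h1 := hstep 0 (by omega)
      have h2 := le_of_abs_le (inner_M_le M hM (e 0) (W 0))
      have h3 := hw 0 (by omega)
      have h4 := he 0 (by omega)
      have h5 : ‖e 0‖ * ‖W 0‖ ≤ 1 * (2 / S ^ 2) := by gcongr
      have h6 : 1 / (4 * S) * ‖e 0‖ ^ 2 ≤ 1 / (4 * S) * 1 := by
        gcongr
        nlinarith [norm_nonneg (e 0)]
      have h7 := sq_nonneg (‖W (0 + 1)‖ - ‖W 0‖)
      have h8 : Om M W e 0 = 0 := rfl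
      have h9 := sq_nonneg ‖W 0‖
      simp only [Nat.cast_zero, Nat.cast_one, zero_add] at h1 h7 ⊢
      linarith)
    (by
      intro k hk
      have h1 := hstep k hk
      push_cast
      linarith)
  have hlast := neg_le_of_abs_le (inner_M_le M hM (e (N + 1)) (W N))
  have hl2 := hyS ‖e (N + 1)‖ ‖W N‖
  rw [inner_sub_right] at hfin
  push_cast at hsc
  linarith

theorem part0 (h : Alg C P M s 0 W g Gs z x u) (hM : ∀ x, ‖M x‖ ≤ ‖x‖)
    (hVI : ∀ k ≤ 0, 2 * ⟪M (x k) - b, W (k + 1) - W k⟫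
      ≤ ⟪W (k + 1), W (k + 1)⟫ - ⟪W k, W k⟫ - ⟪W (k + 1) - W k, W (k + 1) - W k⟫)
    (hW : ∀ k ≤ 0 + 1, ⟪W k, W k⟫ ≤ 4 / (((0 : ℕ) : ℝ) + 1) ^ 2) (hx0 : ‖x 0‖ ≤ 1)
    {p : E} (hp1 : p ∈ C) (hp2 : ‖p‖ ≤ 1) :
    2 * ((((0 : ℕ) : ℝ) + 1) * ((0 : ℕ) + 2) / 4 * ell M s b (W (0 + 1)) (u 0))
      - 2 * Lsum M s b W 0 p ≤ 2 + 2 / (((0 : ℕ) : ℝ) + 1) := by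
  have h1 := h.final (b := b) hp1
  have hv := hVI 0 le_rfl
  have hw := hW 1 le_rfl
  have h4 : ell M s b (W (0 + 1)) (u 0) = ell M s b (W 0) (u 0)
          + ⟪M (x 0) - b, W (0 + 1) - W 0⟫ + ⟪M (u 0 - x 0), W (0 + 1) - W 0⟫ := by
    simp only [ell, inner_sub_right, map_sub, inner_sub_left]; ring
  have h5 := le_of_abs_le (inner_M_le M hM (u 0 - x 0) (W (0 + 1) - W 0))
  have h6 := norm_add_sq_real (u 0 - x 0) (p - u 0)
  have e1 : u 0 - x 0 + (p - u 0) = p - x 0 := by abel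
  rw [e1] at h6
  have h7 : ‖p - x 0‖ ≤ 2 := by linarith [norm_sub_le p (x 0)]
  have h8 : ‖p - x 0‖ ^ 2 ≤ 4 := by nlinarith [norm_nonneg (p - x 0)]
  have h9 := sq_nonneg (‖u 0 - x 0‖ - ‖W (0 + 1) - W 0‖)
  have h10 := sq_nonneg ‖p - u 0‖
  have h11 := real_inner_self_nonneg (x := W 0)
  rw [real_inner_self_eq_norm_sq (W (0 + 1) - W 0)] at hv
  rw [h4]
  simp only [Rem] at h1
  norm_num at h1 hw hv h4 h5 h9 ⊢
  nlinarith

end PartB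
end Nst
namespace Nst
section Wrap
variable {E F : Type*} [NormedAddCommGroup E] [InnerProductSpace ℝ E]
  [NormedAddCommGroup F] [InnerProductSpace ℝ F]

open scoped RealInnerProductSpace

theorem core {C : Set E} {P : E → E} {M : E →ₗ[ℝ] F} {s : E} {N : ℕ} {W : ℕ → F}
    {g Gs z x u : ℕ → E} {b : F} (h : Alg C P M s N W g Gs z x u) (hM : ∀ x, ‖M x‖ ≤ ‖x‖)
    (hVI : ∀ k ≤ N, 2 * ⟪M (x k) - b, W (k + 1) - W k⟫
      ≤ ⟪W (k + 1), W (k + 1)⟫ - ⟪W k, W k⟫ - ⟪W (k + 1) - W k, W (k + 1) - W k⟫)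
    (hW : ∀ k ≤ N + 1, ⟪W k, W k⟫ ≤ 4 / ((N : ℝ) + 1) ^ 2) (hx0 : ‖x 0‖ ≤ 1)
    {p : E} (hp1 : p ∈ C) (hp2 : ‖p‖ ≤ 1) :
    2 * (((N : ℝ) + 1) * (N + 2) / 4 * ell M s b (W (N + 1)) (u N))
      - 2 * Lsum M s b W N p ≤ 2 + 2 / ((N : ℝ) + 1) := by
  rcases Nat.eq_zero_or_pos N with h0 | h0
  · subst h0
    exact part0 h hM hVI hW hx0 hp1 hp2
  · rcases Nat.lt_or_ge N 700 with h1 | h1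
    · exact partA h hM hVI hW hx0 h0 h1 hp1 hp2
    · exact partB h hM hVI hW hx0 h1 hp1 hp2

theorem near_vi {C : Set E} (hC : Convex ℝ C) {y p : E} (hp : p ∈ C)
    (h : ∀ q ∈ C, ‖y - p‖ ≤ ‖y - q‖) : ∀ q ∈ C, ⟪y - p, q - p⟫ ≤ 0 := by
  refine (norm_eq_iInf_iff_real_inner_le_zero hC hp).1 ?_
  haveI : Nonempty C := ⟨⟨p, hp⟩⟩
  refine le_antisymm (le_ciInf fun q => h q q.2) ?_
  exact ciInf_le ⟨0, by rintro _ ⟨q, rfl⟩; exact norm_nonneg _⟩ (⟨p, hp⟩ : C)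

theorem v_mem {D : Set F} (hDconv : Convex ℝ D) {N : ℕ} {V w v : ℕ → F}
    (hVD : ∀ k ≤ N, V k ∈ D)
    (hw0 : w 0 = ((0 : ℝ) + 1) • V 0)
    (hwk : ∀ k, k + 1 ≤ N → w (k + 1) = w k + ((k : ℝ) + 2) • V (k + 1))
    (hv : ∀ k ≤ N, v k = (2 / (((k : ℝ) + 1) * ((k : ℝ) + 2))) • w k) :
    ∀ k ≤ N, v k ∈ D
  | 0, h0 => by
      rw [hv 0 h0, hw0, smul_smul]
      norm_num
      exact hVD 0 h0
  | k + 1, hk => by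
      have ih := v_mem hDconv hVD hw0 hwk hv k (by omega)
      have e : v (k + 1) = v k + (2 / ((k : ℝ) + 3)) • (V (k + 1) - v k) := by
        rw [hv _ hk, hwk k hk, hv k (by omega)]
        push_cast
        have e1 : (2 / (((k : ℝ) + 1 + 1) * ((k : ℝ) + 1 + 2)))
          = (1 - 2 / ((k : ℝ) + 3)) * (2 / (((k : ℝ) + 1) * ((k : ℝ) + 2))) := by
          field_simp
          ring
        have e2 : (2 / (((k : ℝ) + 1 + 1) * ((k : ℝ) + 1 + 2))) * ((k : ℝ) + 2)
          = 2 / ((k : ℝ) + 3) := by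
          field_simp
          ring
        rw [smul_add, smul_smul, e2, e1]
        module
      rw [e]
      refine hDconv.add_smul_sub_mem ih (hVD _ hk) ⟨by positivity, ?_⟩
      rw [div_le_one (by positivity)]
      linarith [Nat.cast_nonneg (α := ℝ) k]

variable [CompleteSpace E] [CompleteSpace F]

theorem gap {C : Set E} {D : Set F} (hCconv : Convex ℝ C) (hDconv : Convex ℝ D)
    {c₁ : E} {c₂ : F} {r₁ r₂ : ℝ} (hr₁ : 0 < r₁) (hr₂ : 0 < r₂)
    (hCball : C ⊆ Metric.closedBall c₁ r₁) (hDball : D ⊆ Metric.closedBall c₂ r₂)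
    (L : E →L[ℝ] F) (hL : L ≠ 0) (s : E) (b : F)
    (PC : E → E) (hPC : ∀ y, PC y ∈ C ∧ ∀ x ∈ C, ‖y - PC y‖ ≤ ‖y - x‖)
    (PD : F → F) (hPD : ∀ y, PD y ∈ D ∧ ∀ x ∈ D, ‖y - PD y‖ ≤ ‖y - x‖)
    (N : ℕ) (μ : ℝ) (hμ : μ = (2 * ‖L‖ / ((N : ℝ) + 1)) * (r₁ / r₂))
    (x u z G Gacc : ℕ → E) (V w v : ℕ → F) (hx0 : x 0 ∈ C)
    (hV : ∀ k ≤ N, V k = PD (c₂ + (1 / μ) • (L (x k) - b)))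
    (hw0 : w 0 = ((0 : ℝ) + 1) • V 0)
    (hwk : ∀ k, k + 1 ≤ N → w (k + 1) = w k + ((k : ℝ) + 2) • V (k + 1))
    (hv : ∀ k ≤ N, v k = (2 / (((k : ℝ) + 1) * ((k : ℝ) + 2))) • w k)
    (hG : ∀ k ≤ N, G k = s + (ContinuousLinearMap.adjoint L) (V k))
    (hGacc0 : Gacc 0 = (((0 : ℝ) + 1) / 2) • G 0)
    (hGacck : ∀ k, k + 1 ≤ N → Gacc (k + 1) = Gacc k + (((k : ℝ) + 2) / 2) • G (k + 1))
    (hu : ∀ k ≤ N, u k = PC (x k - (μ / ‖L‖ ^ 2) • G k))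
    (hz : ∀ k ≤ N, z k = PC (c₁ - (μ / ‖L‖ ^ 2) • Gacc k))
    (hx : ∀ k, k + 1 ≤ N →
      x (k + 1) = (2 / ((k : ℝ) + 3)) • z k + (1 - 2 / ((k : ℝ) + 3)) • u k)
    {p : E} (hp : p ∈ C) {v' : F} (hv' : v' ∈ D) :
    (⟪u N, s⟫ + ⟪L (u N), v'⟫ - ⟪b, v'⟫) - (⟪p, s⟫ + ⟪L p, v N⟫ - ⟪b, v N⟫)
      ≤ 2 * r₁ * r₂ * ‖L‖ / ((N : ℝ) + 1) := by
  have hl : 0 < ‖L‖ := norm_pos_iff.2 hL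
  set l := ‖L‖ with hldef
  have hn : (0 : ℝ) < (N : ℝ) + 1 := by positivity
  have hμ0 : 0 < μ := by rw [hμ]; positivity
  set γ : ℝ := 2 / (((N : ℝ) + 1) * r₂ * l) with hγ
  have hγ0 : 0 < γ := by positivity
  have hμγ : μ / l ^ 2 = r₁ * γ := by rw [hμ, hγ]; field_simp
  have hμl : γ * l * (1 / μ) = 1 / (l * r₁) := by rw [hμ, hγ]; field_simp
  set Vf : ℕ → F := fun k => if k ≤ N then V k else v' with hVf
  have hVf1 : ∀ k ≤ N, Vf k = V k := fun k hk => by simp [hVf, hk]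
  have hVf2 : Vf (N + 1) = v' := by simp [hVf]
  have hVD : ∀ k, Vf k ∈ D := by
    intro k
    by_cases hk : k ≤ N
    · rw [hVf1 k hk, hV k hk]; exact (hPD _).1
    · simp [hVf, hk, hv']
  set M : E →ₗ[ℝ] F := l⁻¹ • (L : E →ₗ[ℝ] F) with hMdef
  have hMa : ∀ q, M q = l⁻¹ • L q := fun q => rfl
  set s' : E := γ • (s + (ContinuousLinearMap.adjoint L) c₂) with hs'
  set b' : F := (1 / (l * r₁)) • (b - L c₁) with hb'
  set nm : E → E := fun q => r₁⁻¹ • (q - c₁) with hnm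
  set W : ℕ → F := fun k => (γ * l) • (Vf k - c₂) with hWd
  have hadj : ∀ (y : F) (q : E), ⟪(ContinuousLinearMap.adjoint L) y, q⟫ = ⟪L q, y⟫ := by
    intro y q
    rw [ContinuousLinearMap.adjoint_inner_left, real_inner_comm]
  have hAlg : Alg {y | c₁ + r₁ • y ∈ C} (fun y => nm (PC (c₁ + r₁ • y))) M s' N W
      (fun k => γ • G k) (fun k => γ • Gacc k) (fun k => nm (z k)) (fun k => nm (x k))
      (fun k => nm (u k)) := by
    have hback : ∀ q, c₁ + r₁ • nm q = q := by
      intro q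
      simp only [hnm]
      rw [smul_smul, mul_inv_cancel₀ hr₁.ne', one_smul]; abel
    refine ⟨?_, ?_, ?_, ?_, ?_, ?_, ?_, ?_, ?_⟩
    · intro y hy y2 hy2 a b ha hb hab
      have := hCconv hy hy2 ha hb hab
      simp only [Set.mem_setOf_eq] at this ⊢
      convert this using 1
      rw [smul_add, smul_add, smul_add]
      have : c₁ = a • c₁ + b • c₁ := by rw [← add_smul, hab, one_smul]
      nth_rewrite 1 [this]
      module
    · intro y
      simp only [Set.mem_setOf_eq, hback]
      exact (hPC _).1
    · intro y q hq
      have h1 := near_vi hCconv (hPC (c₁ + r₁ • y)).1 (hPC (c₁ + r₁ • y)).2 _ hq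
      have e1 : y - nm (PC (c₁ + r₁ • y)) = r₁⁻¹ • (c₁ + r₁ • y - PC (c₁ + r₁ • y)) := by
        have : y = r₁⁻¹ • (r₁ • y) := by rw [smul_smul, inv_mul_cancel₀ hr₁.ne', one_smul]
        nth_rewrite 1 [this]
        simp only [hnm]
        module
      have e2 : q - nm (PC (c₁ + r₁ • y)) = r₁⁻¹ • (c₁ + r₁ • q - PC (c₁ + r₁ • y)) := by
        have : q = r₁⁻¹ • (r₁ • q) := by rw [smul_smul, inv_mul_cancel₀ hr₁.ne', one_smul]
        nth_rewrite 1 [this]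
        simp only [hnm]
        module
      rw [e1, e2, real_inner_smul_left, real_inner_smul_right]
      have h2 : 0 < r₁⁻¹ := by positivity
      nlinarith [mul_nonneg (mul_nonneg h2.le h2.le) (neg_nonneg.2 h1)]
    · intro k hk q
      simp only [hWd, hs', hMa, hVf1 k hk]
      rw [hG k hk]
      simp only [real_inner_smul_left, real_inner_smul_right, inner_add_left, inner_sub_right, hadj]
      field_simp
      ring
    · simp only [hGacc0, smul_smul]; congr 1; ring
    · intro k hk
      simp only [hGacck k hk, smul_add, smul_smul]; congr 2; ring
    · intro k hk
      rw [hu k hk, hμγ]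
      congr 2
      rw [smul_sub, ← add_sub_assoc, hback, smul_smul]
    · intro k hk
      rw [hz k hk, hμγ]
      congr 2
      rw [smul_neg, ← sub_eq_add_neg, smul_smul]
    · intro k hk
      simp only [hnm, hx k hk]
      module
  have hM : ∀ q, ‖M q‖ ≤ ‖q‖ := by
    intro q
    rw [hMa, norm_smul, norm_inv, Real.norm_of_nonneg hl.le, inv_mul_le_iff₀ hl]
    exact L.le_opNorm q
  have hnmle : ∀ q ∈ C, ‖nm q‖ ≤ 1 := by
    intro q hq
    have h1 := hCball hq
    rw [mem_closedBall_iff_norm] at h1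
    simp only [hnm]
    rw [norm_smul, norm_inv, Real.norm_of_nonneg hr₁.le, inv_mul_le_iff₀ hr₁]
    linarith
  have hMb : ∀ q, M (nm q) - b' = (1 / (l * r₁)) • (L q - b) := by
    intro q
    simp only [hMa, hnm, hb', map_smul, map_sub]
    rw [smul_smul, show l⁻¹ * r₁⁻¹ = 1 / (l * r₁) by field_simp]
    module
  have hVI : ∀ k ≤ N, 2 * ⟪M (nm (x k)) - b', W (k + 1) - W k⟫
      ≤ ⟪W (k + 1), W (k + 1)⟫ - ⟪W k, W k⟫ - ⟪W (k + 1) - W k, W (k + 1) - W k⟫ := by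
    intro k hk
    have h1 := near_vi hDconv (hPD (c₂ + (1 / μ) • (L (x k) - b))).1
      (hPD (c₂ + (1 / μ) • (L (x k) - b))).2 _ (hVD (k + 1))
    rw [← hV k hk, ← hVf1 k hk] at h1
    rw [hMb, ← hμl]
    have e1 : W (k + 1) - W k = (γ * l) • (Vf (k + 1) - Vf k) := by
      simp only [hWd]; module
    have e2 : ⟪W (k + 1), W (k + 1)⟫ - ⟪W k, W k⟫ - ⟪W (k + 1) - W k, W (k + 1) - W k⟫
      = 2 * ⟪W k, W (k + 1) - W k⟫ := by
      simp only [inner_sub_left, inner_sub_right, real_inner_comm (W k) (W (k + 1))]; ring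
    rw [e2, e1]
    simp only [hWd, real_inner_smul_left, real_inner_smul_right]
    have e3 : c₂ + (1 / μ) • (L (x k) - b) - Vf k = (1 / μ) • (L (x k) - b) - (Vf k - c₂) := by
      abel
    rw [e3, inner_sub_left, real_inner_smul_left] at h1
    have h2 : 0 < (γ * l) * (γ * l) := by positivity
    nlinarith [mul_le_mul_of_nonneg_left h1 h2.le]
  have hW : ∀ k ≤ N + 1, ⟪W k, W k⟫ ≤ 4 / ((N : ℝ) + 1) ^ 2 := by
    intro k _
    have h1 := hDball (hVD k)
    rw [mem_closedBall_iff_norm] at h1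
    have h2 : ‖W k‖ ≤ 2 / ((N : ℝ) + 1) := by
      simp only [hWd]
      rw [norm_smul, Real.norm_of_nonneg (by positivity)]
      calc γ * l * ‖Vf k - c₂‖ ≤ γ * l * r₂ := by gcongr
        _ = _ := by rw [hγ]; field_simp
    rw [real_inner_self_eq_norm_sq]
    calc ‖W k‖ ^ 2 ≤ (2 / ((N : ℝ) + 1)) ^ 2 := by gcongr
      _ = _ := by rw [div_pow]; norm_num
  have hp' : nm p ∈ {y | c₁ + r₁ • y ∈ C} := by
    simp only [Set.mem_setOf_eq, hnm]
    rw [smul_smul, mul_inv_cancel₀ hr₁.ne', one_smul, add_sub_cancel]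
    exact hp
  have hcore := core (b := b') hAlg hM hVI hW (hnmle _ hx0) hp' (hnmle p hp)
  -- translate back
  set g0 : ℝ := ⟪s, c₁⟫ + ⟪L c₁, c₂⟫ - ⟪b, c₂⟫ with hg0
  have hell : ∀ k q, ell M s' b' (W k) (nm q)
      = γ / r₁ * (⟪q, s⟫ + ⟪L q - b, Vf k⟫ - g0) := by
    intro k q
    rw [ell, hMb]
    simp only [hs', hnm, hWd, real_inner_smul_left, real_inner_smul_right, inner_add_left, hadj,
      inner_sub_left, inner_sub_right, map_sub, map_smul, hg0, real_inner_comm s q]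
    field_simp
    ring
  have hLs : ∀ k ≤ N, ∀ q, Lsum M s' b' W k (nm q)
      = γ / r₁ * (1 / 2 * ⟪L q - b, w k⟫ + ((k : ℝ) + 1) * (k + 2) / 4 * (⟪q, s⟫ - g0)) := by
    intro k
    induction k with
    | zero =>
      intro hk q
      rw [Lsum, hell, hw0, hVf1 0 hk, real_inner_smul_right]
      push_cast
      ring
    | succ k ih =>
      intro hk q
      rw [Lsum, hell, hwk k hk, hVf1 _ hk, ih (by omega), inner_add_right, real_inner_smul_right]
      push_cast
      ring
  have hwv : w N = (((N : ℝ) + 1) * (N + 2) / 2) • v N := by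
    rw [hv N le_rfl, smul_smul]
    have : ((N : ℝ) + 1) * (N + 2) / 2 * (2 / (((N : ℝ) + 1) * ((N : ℝ) + 2))) = 1 := by
      field_simp
    rw [this, one_smul]
  rw [hell, hLs N le_rfl, hwv, hVf2, real_inner_smul_right, inner_sub_left, inner_sub_left] at hcore
  set X := (⟪u N, s⟫ + ⟪L (u N), v'⟫ - ⟪b, v'⟫) - (⟪p, s⟫ + ⟪L p, v N⟫ - ⟪b, v N⟫) with hX
  have h9 : γ / r₁ * (((N : ℝ) + 1) * (N + 2) / 2) * X ≤ 2 + 2 / ((N : ℝ) + 1) := by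
    rw [hX]; linarith
  have h10 : γ / r₁ * (((N : ℝ) + 1) * (N + 2) / 2) * (2 * r₁ * r₂ * l / ((N : ℝ) + 1))
      = 2 + 2 / ((N : ℝ) + 1) := by
    rw [hγ]; field_simp; ring
  rw [← h10] at h9
  exact le_of_mul_le_mul_left h9 (by positivity)

end Wrap
end Nst


/- STATEMENT 12: Nesterov's smoothing algorithm for the bilinear saddle point
problem `min_{u∈C} max_{v∈D} ⟨u,s⟩ + ⟨Lu,v⟩ − ⟨b,v⟩` produces feasible iterates
`u⁽ᵏ⁾ ∈ C`, `v⁽ᵏ⁾ ∈ D`, and after `N+1` iterations the primal-dual gap satisfies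
`f(u⁽ᴺ⁾) − f(u*) ≤ f(u⁽ᴺ⁾) − f_D(v⁽ᴺ⁾) ≤ 2 r₁ r₂ Ĉ / (N+1)` for any `Ĉ ≥ ‖L‖`. -/
open scoped RealInnerProductSpace in
theorem stmt12 (n m : ℕ)
    (C : Set (EuclideanSpace ℝ (Fin n))) (D : Set (EuclideanSpace ℝ (Fin m)))
    (hCne : C.Nonempty) (hCcomp : IsCompact C) (hCconv : Convex ℝ C)
    (hDne : D.Nonempty) (hDcomp : IsCompact D) (hDconv : Convex ℝ D)
    (c₁ : EuclideanSpace ℝ (Fin n)) (c₂ : EuclideanSpace ℝ (Fin m))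
    (r₁ r₂ : ℝ) (hr₁ : 0 < r₁) (hr₂ : 0 < r₂)
    (hc₁ : c₁ ∈ C) (hc₂ : c₂ ∈ D)
    (hCball : C ⊆ Metric.closedBall c₁ r₁) (hDball : D ⊆ Metric.closedBall c₂ r₂)
    (L : EuclideanSpace ℝ (Fin n) →L[ℝ] EuclideanSpace ℝ (Fin m)) (hL : L ≠ 0)
    (s : EuclideanSpace ℝ (Fin n)) (b : EuclideanSpace ℝ (Fin m))
    -- nearest-point projections onto C and D
    (PC : EuclideanSpace ℝ (Fin n) → EuclideanSpace ℝ (Fin n))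
    (hPC : ∀ y, PC y ∈ C ∧ ∀ x ∈ C, ‖y - PC y‖ ≤ ‖y - x‖)
    (PD : EuclideanSpace ℝ (Fin m) → EuclideanSpace ℝ (Fin m))
    (hPD : ∀ y, PD y ∈ D ∧ ∀ x ∈ D, ‖y - PD y‖ ≤ ‖y - x‖)
    -- objectives
    (g : EuclideanSpace ℝ (Fin n) → EuclideanSpace ℝ (Fin m) → ℝ)
    (hg : ∀ u v, g u v = ⟪u, s⟫ + ⟪L u, v⟫ - ⟪b, v⟫)
    (f : EuclideanSpace ℝ (Fin n) → ℝ) (hf : ∀ u, f u = sSup ((g u) '' D))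
    (fD : EuclideanSpace ℝ (Fin m) → ℝ) (hfD : ∀ v, fD v = sInf ((fun u => g u v) '' C))
    -- the algorithm
    (N : ℕ) (μ : ℝ) (hμ : μ = (2 * ‖L‖ / ((N : ℝ) + 1)) * (r₁ / r₂))
    (x u z G Gacc : ℕ → EuclideanSpace ℝ (Fin n))
    (V w v : ℕ → EuclideanSpace ℝ (Fin m))
    (hx0 : x 0 ∈ C)
    (hV : ∀ k ≤ N, V k = PD (c₂ + (1 / μ) • (L (x k) - b)))
    (hw0 : w 0 = ((0 : ℝ) + 1) • V 0)
    (hwk : ∀ k, k + 1 ≤ N → w (k + 1) = w k + ((k : ℝ) + 2) • V (k + 1))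
    (hv : ∀ k ≤ N, v k = (2 / (((k : ℝ) + 1) * ((k : ℝ) + 2))) • w k)
    (hG : ∀ k ≤ N, G k = s + (ContinuousLinearMap.adjoint L) (V k))
    (hGacc0 : Gacc 0 = (((0 : ℝ) + 1) / 2) • G 0)
    (hGacck : ∀ k, k + 1 ≤ N → Gacc (k + 1) = Gacc k + (((k : ℝ) + 2) / 2) • G (k + 1))
    (hu : ∀ k ≤ N, u k = PC (x k - (μ / ‖L‖ ^ 2) • G k))
    (hz : ∀ k ≤ N, z k = PC (c₁ - (μ / ‖L‖ ^ 2) • Gacc k))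
    (hx : ∀ k, k + 1 ≤ N →
      x (k + 1) = (2 / ((k : ℝ) + 3)) • z k + (1 - 2 / ((k : ℝ) + 3)) • u k) :
    (∀ k ≤ N, u k ∈ C ∧ v k ∈ D) ∧
    ∀ Chat : ℝ, ‖L‖ ≤ Chat →
      ∀ ustar ∈ C, (∀ u' ∈ C, f ustar ≤ f u') →
        f (u N) - f ustar ≤ f (u N) - fD (v N) ∧
        f (u N) - fD (v N) ≤ 2 * r₁ * r₂ * Chat / ((N : ℝ) + 1) := by
  have hgap := fun p hp v' hv' => Nst.gap hCconv hDconv hr₁ hr₂ hCball hDball L hL s b PC hPC PD hPD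
    N μ hμ x u z G Gacc V w v hx0 hV hw0 hwk hv hG hGacc0 hGacck hu hz hx (p := p) hp (v' := v') hv'
  have huC : ∀ k ≤ N, u k ∈ C := fun k hk => by rw [hu k hk]; exact (hPC _).1
  have hvD : ∀ k ≤ N, v k ∈ D := Nst.v_mem hDconv
    (fun k hk => by rw [hV k hk]; exact (hPD _).1) hw0 hwk hv
  refine ⟨fun k hk => ⟨huC k hk, hvD k hk⟩, ?_⟩
  intro Chat hChat ustar hustar hmin
  have hc1 : ∀ q, Continuous (g q) := by
    intro q
    have : g q = fun y => ⟪q, s⟫ + ⟪L q, y⟫ - ⟪b, y⟫ := funext (hg q)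
    rw [this]; fun_prop
  have hc2 : ∀ y, Continuous (fun q => g q y) := by
    intro y
    have : (fun q => g q y) = fun q => ⟪q, s⟫ + ⟪L q, y⟫ - ⟪b, y⟫ := funext (fun q => hg q y)
    rw [this]; fun_prop
  have hb1 : ∀ q, BddAbove (g q '' D) := fun q => (hDcomp.image (hc1 q)).bddAbove
  have hb2 : ∀ y, BddBelow ((fun q => g q y) '' C) := fun y => (hCcomp.image (hc2 y)).bddBelow
  constructor
  · have h1 : g ustar (v N) ≤ f ustar := by
      rw [hf]; exact le_csSup (hb1 _) ⟨v N, hvD N le_rfl, rfl⟩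
    have h2 : fD (v N) ≤ g ustar (v N) := by
      rw [hfD]; exact csInf_le (hb2 _) ⟨ustar, hustar, rfl⟩
    linarith
  · have h3 : f (u N) ≤ fD (v N) + 2 * r₁ * r₂ * ‖L‖ / ((N : ℝ) + 1) := by
      rw [hf]
      refine csSup_le (hDne.image _) ?_
      rintro _ ⟨y, hy, rfl⟩
      rw [← sub_le_iff_le_add, hfD]
      refine le_csInf (hCne.image _) ?_
      rintro _ ⟨q, hq, rfl⟩
      have h4 := hgap q hq y hy
      simp only [hg]
      linarith
    have h5 : 2 * r₁ * r₂ * ‖L‖ / ((N : ℝ) + 1) ≤ 2 * r₁ * r₂ * Chat / ((N : ℝ) + 1) := by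
      gcongr
    linarith
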